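/- arXiv:1409.5842 — 2 statements merged into one kernel-verified Lean document; each statement's English description precedes it below -/
import Mathlib

section
/- Let C be a plane curve of degree d over F_q without F_q-line components such that N_q(C) = (d-1)q + 1. Then the defining polynomial of C is irreducible over the algebraic closure of F_q (C is absolutely irreducible), and no F_q-point of C is a singular point of C. -/
open MvPolynomial

variable {K : Type} [Field K]

/-- The linear form `∑ aᵢ Xᵢ` as a multivariate polynomial. -/
noncomputable def linForm {n : ℕ} (a : Fin n → K) : MvPolynomial (Fin n) K :=
  ∑ i, C (a i) * X i

/-- The linear form `v ↦ ∑ aᵢ vᵢ` as a linear map. -/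
noncomputable def linMap {n : ℕ} (a : Fin n → K) : (Fin n → K) →ₗ[K] K :=
  ∑ i, a i • LinearMap.proj i

/-- Substitution `F(M·X)` of a linear change of variables into `F`. -/
noncomputable def substLin {n : ℕ} (M : Matrix (Fin n) (Fin n) K)
    (F : MvPolynomial (Fin n) K) : MvPolynomial (Fin n) K :=
  MvPolynomial.aeval (fun i => ∑ j, C (M i j) * X j) F

/-- Projective equivalence over `K` of two forms. -/
def ProjEquiv {n : ℕ} (F G : MvPolynomial (Fin n) K) : Prop :=
  ∃ M : Matrix (Fin n) (Fin n) K, IsUnit M.det ∧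
    ∃ c : K, c ≠ 0 ∧ substLin M F = C c * G

/-- An `F_q`-line in `P^3` (resp. `P^2`), as a 2-dimensional linear subspace. -/
def IsLine {n : ℕ} (W : Submodule K (Fin n → K)) : Prop := Module.finrank K W = 2

/-- An `F_q`-plane in `P^3`, as a 3-dimensional linear subspace. -/
def IsPlane (W : Submodule K (Fin 4 → K)) : Prop := Module.finrank K W = 3

/-- The section `S ∩ H` of the surface `S = {F = 0}` with the plane `H` given by the
subspace `W` is a planar `F_q`-pencil of degree `d` with vertex `P`: modulo the linear
form defining `H`, `F` is a nonzero scalar times a product of `d` linear forms over `F_q`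
cutting out `d` pairwise distinct lines of `H`, all passing through the point `P`. -/
def IsPencil (F : MvPolynomial (Fin 4) K) (d : ℕ)
    (W : Submodule K (Fin 4 → K)) (P : Projectivization K (Fin 4 → K)) : Prop :=
  ∃ (a : Fin 4 → K) (m : Fin d → Fin 4 → K) (c : K) (g : MvPolynomial (Fin 4) K),
    a ≠ 0 ∧ W = LinearMap.ker (linMap a) ∧ c ≠ 0 ∧
    F = C c * (∏ i, linForm (m i)) + linForm a * g ∧
    (∀ i, IsLine (LinearMap.ker (linMap a) ⊓ LinearMap.ker (linMap (m i)))) ∧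
    (∀ i j, i ≠ j →
      LinearMap.ker (linMap a) ⊓ LinearMap.ker (linMap (m i)) ≠
      LinearMap.ker (linMap a) ⊓ LinearMap.ker (linMap (m j))) ∧
    P.rep ∈ W ∧ (∀ i, linMap (m i) P.rep = 0)

/-- The restriction of `F` to the plane `H` given by the subspace `W` has a linear
factor over `F_q` (i.e. the section `S ∩ H` has an `F_q`-line component). -/
def SectionHasLineComp (F : MvPolynomial (Fin 4) K)
    (W : Submodule K (Fin 4 → K)) : Prop :=
  ∃ (a b : Fin 4 → K) (h g : MvPolynomial (Fin 4) K),
    a ≠ 0 ∧ W = LinearMap.ker (linMap a) ∧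
    IsLine (LinearMap.ker (linMap a) ⊓ LinearMap.ker (linMap b)) ∧
    F = linForm b * h + linForm a * g

section LineRestriction

variable {σ L : Type*} [Field L]

/-- The restriction `t ↦ F (Q + t P)` of `F` to the line through `P` and `Q`. -/
noncomputable def lineRestrict (P Q : σ → L) : MvPolynomial σ L →ₐ[L] Polynomial L :=
  aeval fun i => Polynomial.C (Q i) + Polynomial.C (P i) * Polynomial.X

lemma eval_lineRestrict (P Q : σ → L) (F : MvPolynomial σ L) (t : L) :
    (lineRestrict P Q F).eval t = eval (Q + t • P) F := by
  induction F using MvPolynomial.induction_on with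
  | C a => simp [lineRestrict, Polynomial.algebraMap_eq]
  | add p q hp hq => simp [hp, hq]
  | mul_X p i hp =>
    have hX : (lineRestrict P Q (X i)).eval t = Q i + P i * t := by simp [lineRestrict]
    rw [map_mul, Polynomial.eval_mul, hp, hX, map_mul, eval_X]
    simp [mul_comm t]

lemma coeff_zero_lineRestrict (P Q : σ → L) (F : MvPolynomial σ L) :
    (lineRestrict P Q F).coeff 0 = eval Q F := by
  rw [Polynomial.coeff_zero_eq_eval_zero, eval_lineRestrict]
  simp

lemma coeff_one_lineRestrict [Fintype σ] (P Q : σ → L) (F : MvPolynomial σ L) :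
    (lineRestrict P Q F).coeff 1 = ∑ i, P i * eval Q (pderiv i F) := by
  classical
  induction F using MvPolynomial.induction_on with
  | C a => simp [lineRestrict, Polynomial.algebraMap_eq]
  | add p q hp hq => simp [hp, hq, mul_add, Finset.sum_add_distrib]
  | mul_X p i hp =>
    have hX : lineRestrict P Q (X i) =
        Polynomial.C (Q i) + Polynomial.C (P i) * Polynomial.X := by simp [lineRestrict]
    rw [map_mul, hX, mul_add, Polynomial.coeff_add, Polynomial.coeff_mul_C, hp, mul_left_comm,
      Polynomial.coeff_C_mul, Polynomial.coeff_mul_X, coeff_zero_lineRestrict]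
    simp only [Derivation.leibniz, pderiv_X, smul_eq_mul, map_add, map_mul, eval_X, mul_add,
      Finset.sum_add_distrib, Pi.single_apply]
    simp [apply_ite (eval Q), Finset.sum_mul]
    rw [add_comm]
    congr 1
    exact Finset.sum_congr rfl fun j _ => by ring

lemma MvPolynomial.IsHomogeneous.eval_smul {F : MvPolynomial σ L} {d : ℕ}
    (hF : F.IsHomogeneous d) (c : L) (v : σ → L) : eval (c • v) F = c ^ d * eval v F := by
  rw [eval_eq, eval_eq, Finset.mul_sum]
  refine Finset.sum_congr rfl fun m hm => ?_
  simp only [Pi.smul_apply, smul_eq_mul, mul_pow, Finset.prod_mul_distrib,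
    Finset.prod_pow_eq_pow_sum]
  rw [← hF.degree_eq_sum_deg_support hm]
  ring

lemma natDegree_lineRestrict_le {F : MvPolynomial σ L} {d : ℕ} (hF : F.IsHomogeneous d)
    (P Q : σ → L) : (lineRestrict P Q F).natDegree ≤ d := by
  refine (aeval_natDegree_le F hF.totalDegree_le _ fun i => ?_).trans (mul_one d).le
  compute_degree

lemma reflect_lineRestrict [Infinite L] {F : MvPolynomial σ L} {d : ℕ} (hF : F.IsHomogeneous d)
    (P Q : σ → L) : (lineRestrict P Q F).reflect d = lineRestrict Q P F := by
  refine Polynomial.eq_of_infinite_eval_eq _ _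
    ((Set.infinite_univ.sdiff (Set.finite_singleton (0 : L))).mono ?_)
  rintro t ⟨-, ht⟩
  have ht : t ≠ 0 := by simpa using ht
  let _ := invertibleOfNonzero (inv_ne_zero ht)
  have h := Polynomial.eval₂_reflect_mul_pow (RingHom.id L) t⁻¹ d (lineRestrict P Q F)
    (natDegree_lineRestrict_le hF P Q)
  rw [invOf_eq_inv, inv_inv] at h
  change (Polynomial.reflect d _).eval t * _ = (lineRestrict P Q F).eval t⁻¹ at h
  have hv : P + t • Q = t • (Q + t⁻¹ • P) := by
    rw [smul_add, smul_smul, mul_inv_cancel₀ ht, one_smul, add_comm]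
  rw [Set.mem_ofPred_eq, eval_lineRestrict, hv, hF.eval_smul, ← eval_lineRestrict, ← h, mul_left_comm,
    ← mul_pow, mul_inv_cancel₀ ht, one_pow, mul_one]

lemma coeff_top_lineRestrict [Infinite L] {F : MvPolynomial σ L} {d : ℕ} (hF : F.IsHomogeneous d)
    (P Q : σ → L) : (lineRestrict P Q F).coeff d = eval P F := by
  rw [← coeff_zero_lineRestrict Q P, ← reflect_lineRestrict hF P Q, Polynomial.coeff_reflect,
    Polynomial.revAt_le d.zero_le, Nat.sub_zero]

lemma coeff_sub_one_lineRestrict [Fintype σ] [Infinite L] {F : MvPolynomial σ L} {d : ℕ}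
    (hF : F.IsHomogeneous d) (hd : 1 ≤ d) (P Q : σ → L) :
    (lineRestrict P Q F).coeff (d - 1) = ∑ i, Q i * eval P (pderiv i F) := by
  rw [← coeff_one_lineRestrict Q P, ← reflect_lineRestrict hF P Q, Polynomial.coeff_reflect,
    Polynomial.revAt_le hd]

lemma Polynomial.natDegree_lt_of_coeff_eq_zero {f : Polynomial L} {d : ℕ} (hf : f ≠ 0)
    (hd : f.natDegree ≤ d) (hc : f.coeff d = 0) : f.natDegree < d :=
  hd.lt_of_ne fun h => hf (leadingCoeff_eq_zero.mp (h ▸ hc : f.coeff f.natDegree = 0))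

/-- A form vanishing at `P` restricts to a polynomial of degree less than its own. -/
lemma natDegree_lineRestrict_lt [Infinite L] {F : MvPolynomial σ L} {d : ℕ}
    (hF : F.IsHomogeneous d) {P Q : σ → L} (hP : eval P F = 0) (h0 : lineRestrict P Q F ≠ 0) :
    (lineRestrict P Q F).natDegree + 1 ≤ d :=
  Polynomial.natDegree_lt_of_coeff_eq_zero h0 (natDegree_lineRestrict_le hF P Q)
    ((coeff_top_lineRestrict hF P Q).trans hP)

/-- On a line tangent at `P` the degree drops by two. -/
lemma natDegree_lineRestrict_add_two_le [Fintype σ] [Infinite L] {F : MvPolynomial σ L} {d : ℕ}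
    (hF : F.IsHomogeneous d) {P Q : σ → L} (hP : eval P F = 0)
    (hQ : ∑ i, Q i * eval P (pderiv i F) = 0) (h0 : lineRestrict P Q F ≠ 0) :
    (lineRestrict P Q F).natDegree + 2 ≤ d := by
  have h1 := natDegree_lineRestrict_lt hF hP h0
  have := Polynomial.natDegree_lt_of_coeff_eq_zero h0 (Nat.le_sub_of_add_le h1)
    ((coeff_sub_one_lineRestrict hF (by omega) P Q).trans hQ)
  omega

end LineRestriction

section HomogeneousFactors

variable {σ L : Type*} [Field L]

/-- The polynomial in a new variable `T` whose coefficients are the homogeneous components. -/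
noncomputable def gradingPolynomial (σ L : Type*) [Field L] :
    MvPolynomial σ L →ₐ[L] Polynomial (MvPolynomial σ L) :=
  aeval fun i => Polynomial.C (X i) * Polynomial.X

lemma gradingPolynomial_monomial (m : σ →₀ ℕ) (a : L) :
    gradingPolynomial σ L (monomial m a) = Polynomial.monomial m.degree (monomial m a) := by
  rw [gradingPolynomial, aeval_monomial, Finsupp.prod]
  simp only [mul_pow, Finset.prod_mul_distrib, Finset.prod_pow_eq_pow_sum]
  rw [← Polynomial.C_mul_X_pow_eq_monomial, monomial_eq (s := m), Finsupp.prod,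
    IsScalarTower.algebraMap_apply L (MvPolynomial σ L), MvPolynomial.algebraMap_eq,
    Polynomial.algebraMap_eq, Polynomial.C_mul, map_prod, mul_assoc, Finsupp.degree_apply]
  simp

lemma coeff_gradingPolynomial (F : MvPolynomial σ L) (n : ℕ) :
    (gradingPolynomial σ L F).coeff n = homogeneousComponent n F := by
  classical
  induction F using MvPolynomial.induction_on' with
  | monomial m a =>
    rw [gradingPolynomial_monomial, Polynomial.coeff_monomial]
    split_ifs with h
    · exact ((homogeneousComponent_of_mem (isHomogeneous_monomial a h)).trans (if_pos rfl)).symm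
    · exact ((homogeneousComponent_of_mem (isHomogeneous_monomial a rfl)).trans
        (if_neg (Ne.symm h))).symm
  | add p q hp hq => simp [hp, hq]

lemma MvPolynomial.IsHomogeneous.of_mul_left {A B : MvPolynomial σ L} {d : ℕ}
    (h : (A * B).IsHomogeneous d) (h0 : A * B ≠ 0) : ∃ e, A.IsHomogeneous e := by
  classical
  have hinj : ∀ F : MvPolynomial σ L, F ≠ 0 → gradingPolynomial σ L F ≠ 0 := fun F hF hz => hF <| by
    rw [← sum_homogeneousComponent F]
    exact Finset.sum_eq_zero fun n _ => by rw [← coeff_gradingPolynomial, hz, Polynomial.coeff_zero]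
  have hA := hinj A (left_ne_zero_of_mul h0)
  have hB := hinj B (right_ne_zero_of_mul h0)
  have hmono : gradingPolynomial σ L (A * B) = Polynomial.monomial d (A * B) := by
    ext1 n
    rw [coeff_gradingPolynomial, homogeneousComponent_of_mem h, Polynomial.coeff_monomial]
    simp only [eq_comm]
  have hdeg := congrArg Polynomial.natDegree hmono
  have htdeg := congrArg Polynomial.natTrailingDegree hmono
  rw [map_mul, Polynomial.natDegree_mul hA hB, Polynomial.natDegree_monomial_eq _ h0] at hdeg
  rw [map_mul, Polynomial.natTrailingDegree_mul hA hB,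
    Polynomial.natTrailingDegree_monomial h0] at htdeg
  have hA' := Polynomial.natTrailingDegree_le_natDegree (gradingPolynomial σ L A)
  have hB' := Polynomial.natTrailingDegree_le_natDegree (gradingPolynomial σ L B)
  refine ⟨(gradingPolynomial σ L A).natDegree, ?_⟩
  have hcomp : ∀ n, (homogeneousComponent n A).IsHomogeneous
      (gradingPolynomial σ L A).natDegree := by
    intro n
    rcases lt_trichotomy n (gradingPolynomial σ L A).natDegree with hn | hn | hn
    · rw [← coeff_gradingPolynomial, Polynomial.coeff_eq_zero_of_lt_natTrailingDegree (by omega)]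
      exact isHomogeneous_zero _ _ _
    · exact hn ▸ homogeneousComponent_isHomogeneous n A
    · rw [← coeff_gradingPolynomial, Polynomial.coeff_eq_zero_of_natDegree_lt hn]
      exact isHomogeneous_zero _ _ _
  have hsum := IsHomogeneous.sum (Finset.range (A.totalDegree + 1))
    (fun n => homogeneousComponent n A) _ fun n _ => hcomp n
  rwa [sum_homogeneousComponent] at hsum

end HomogeneousFactors
section LinearAlgebra

lemma exists_linearIndependent_pair_dotProduct_eq_zero {P : Fin 3 → K} (hP : P ≠ 0)
    (w : Fin 3 → K) : ∃ R, R ⬝ᵥ w = 0 ∧ LinearIndependent K ![P, R] := by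
  by_contra! h
  simp only [LinearIndependent.pair_iff' hP, ne_eq, not_forall, not_not] at h
  let φ : (Fin 3 → K) →ₗ[K] K := linMap w
  have hφ : ∀ v, φ v = v ⬝ᵥ w := fun v => by
    simp [φ, linMap, dotProduct, LinearMap.sum_apply, mul_comm]
  have hker : LinearMap.ker φ ≤ Submodule.span K {P} := fun v hv =>
    Submodule.mem_span_singleton.mpr (h v (hφ v ▸ hv))
  have h1 := Submodule.finrank_mono hker
  have h2 := φ.finrank_range_add_finrank_ker
  have h3 := Submodule.finrank_le (LinearMap.range φ)
  rw [finrank_span_singleton hP] at h1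
  rw [Module.finrank_fin_fun] at h2
  rw [Module.finrank_self] at h3
  omega

lemma exists_complement_of_linearIndependent_pair {P R : Fin 3 → K}
    (h : LinearIndependent K ![P, R]) :
    ∃ Q, (∀ v, ∃ a b c : K, v = a • Q + b • R + c • P) ∧
      ∀ s : K, LinearIndependent K ![P, Q + s • R] := by
  obtain ⟨Q, hQ⟩ : ∃ Q, Q ∉ Submodule.span K (Set.range ![P, R]) := by
    by_contra! hall
    have h1 := finrank_span_eq_card h
    rw [(Submodule.eq_top_iff'.mpr hall : Submodule.span K (Set.range ![P, R]) = ⊤), finrank_top,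
      Module.finrank_fin_fun] at h1
    simp at h1
  have hP : P ≠ 0 := h.ne_zero 0
  refine ⟨Q, fun v => ?_, fun s => (LinearIndependent.pair_iff' hP).mpr fun a ha => hQ ?_⟩
  · have hind : LinearIndependent K ![Q, P, R] := linearIndependent_finCons.mpr ⟨h, hQ⟩
    have htop := hind.span_eq_top_of_card_eq_finrank (by simp)
    obtain ⟨c, hc⟩ := (Submodule.mem_span_range_iff_exists_fun K).mp
      (htop ▸ Submodule.mem_top (x := v))
    refine ⟨c 0, c 2, c 1, ?_⟩
    rw [← hc, Fin.sum_univ_three]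
    simp only [Matrix.cons_val]
    abel
  · rw [eq_sub_of_add_eq ha.symm]
    exact sub_mem (Submodule.smul_mem _ _ (Submodule.subset_span ⟨0, rfl⟩))
      (Submodule.smul_mem _ _ (Submodule.subset_span ⟨1, rfl⟩))

end LinearAlgebra

section RationalPoints

variable {L : Type*} [Field L] [Algebra K L]

lemma eval_algebraMap_comp_map {σ : Type*} (G : MvPolynomial σ K) (v : σ → K) :
    eval (algebraMap K L ∘ v) (map (algebraMap K L) G) = algebraMap K L (eval v G) := by
  rw [eval_map, ← eval₂_comp]

/-- A form without linear factor over `K` does not vanish identically on any `K`-line. -/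
lemma lineRestrict_map_ne_zero [Infinite L] {G : MvPolynomial (Fin 3) K} {d : ℕ}
    (hG : G.IsHomogeneous d) (hnoline : ¬ ∃ a : Fin 3 → K, a ≠ 0 ∧ linForm a ∣ G)
    {P R : Fin 3 → K} (h : LinearIndependent K ![P, R]) :
    lineRestrict (algebraMap K L ∘ P) (algebraMap K L ∘ R) (map (algebraMap K L) G) ≠ 0 := by
  classical
  intro hzero
  have hF := hG.map (algebraMap K L)
  set F := map (algebraMap K L) G with hFdef
  set a := crossProduct P R with hadef
  have ha : a ≠ 0 := crossProduct_ne_zero_iff_linearIndependent.mpr h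
  have haP : P ⬝ᵥ a = 0 := dot_self_cross P R
  have haR : R ⬝ᵥ a = 0 := dot_cross_self P R
  obtain ⟨Q, hspan, -⟩ := exists_complement_of_linearIndependent_pair h
  have haQ : Q ⬝ᵥ a ≠ 0 := fun h0 => ha <| funext fun i => by
    obtain ⟨x, y, z, hv⟩ := hspan (Pi.single i 1)
    have := congrArg (· ⬝ᵥ a) hv
    simpa [add_dotProduct, smul_dotProduct, haP, haR, h0] using this
  have hPR : ∀ y z : L, eval (y • (algebraMap K L ∘ R) + z • (algebraMap K L ∘ P)) F = 0 := by
    intro y z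
    by_cases hy : y = 0
    · have hc := coeff_top_lineRestrict hF (algebraMap K L ∘ P) (algebraMap K L ∘ R)
      rw [hzero, Polynomial.coeff_zero] at hc
      rw [hy, zero_smul, zero_add, hF.eval_smul, ← hc, mul_zero]
    · have hv : y • (algebraMap K L ∘ R) + z • (algebraMap K L ∘ P) =
          y • ((algebraMap K L ∘ R) + (y⁻¹ * z) • (algebraMap K L ∘ P)) := by
        rw [smul_add, smul_smul, mul_inv_cancel_left₀ hy]
      rw [hv, hF.eval_smul, ← eval_lineRestrict, hzero, Polynomial.eval_zero, mul_zero]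
  have hplane : ∀ v : Fin 3 → L, v ⬝ᵥ (algebraMap K L ∘ a) = 0 → eval v F = 0 := by
    intro v hv
    choose x y z hxyz using fun i : Fin 3 => hspan (Pi.single i 1)
    have hdecomp : v = (∑ i, v i * algebraMap K L (x i)) • (algebraMap K L ∘ Q) +
        ((∑ i, v i * algebraMap K L (y i)) • (algebraMap K L ∘ R) +
        (∑ i, v i * algebraMap K L (z i)) • (algebraMap K L ∘ P)) := by
      funext j
      have hj : ∀ i, algebraMap K L (Pi.single (M := fun _ : Fin 3 => K) i 1 j) =
          algebraMap K L (x i) * algebraMap K L (Q j) +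
          algebraMap K L (y i) * algebraMap K L (R j) +
          algebraMap K L (z i) * algebraMap K L (P j) := fun i => by
        rw [hxyz i]; simp
      have hvj : v j = ∑ i, v i * algebraMap K L (Pi.single (M := fun _ : Fin 3 => K) i 1 j) := by
        simp [Pi.single_apply, apply_ite (algebraMap K L)]
      rw [hvj]
      simp only [hj, Pi.add_apply, Pi.smul_apply, smul_eq_mul, Function.comp_apply, Finset.sum_mul,
        ← Finset.sum_add_distrib]
      exact Finset.sum_congr rfl fun i _ => by ring
    have hcomp : ∀ u : Fin 3 → K,
        (algebraMap K L ∘ u) ⬝ᵥ (algebraMap K L ∘ a) = algebraMap K L (u ⬝ᵥ a) := fun u =>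
      ((algebraMap K L).map_dotProduct u a).symm
    have hx : ∑ i, v i * algebraMap K L (x i) = 0 := by
      rw [hdecomp] at hv
      simp only [add_dotProduct, smul_dotProduct, hcomp, haP, haR, map_zero, smul_eq_mul, mul_zero,
        add_zero] at hv
      exact (mul_eq_zero.mp hv).resolve_right ((map_ne_zero _).mpr haQ)
    rw [hdecomp, hx, zero_smul, zero_add]
    exact hPR _ _
  obtain ⟨i, hi⟩ := Function.ne_iff.mp ha
  rw [Pi.zero_apply] at hi
  let φ : Fin 3 → MvPolynomial (Fin 3) K := fun j =>
    X j - C ((Pi.single i (a i)⁻¹ : Fin 3 → K) j) * linForm a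
  have hφ : aeval φ G = 0 := by
    apply map_injective (algebraMap K L) (algebraMap K L).injective
    rw [map_zero]
    refine MvPolynomial.funext fun v => ?_
    have hval : eval v (map (algebraMap K L) (aeval φ G)) =
        eval (fun j => eval v (map (algebraMap K L) (φ j))) F := by
      simp only [hFdef, eval_map, ← aeval_def, comp_aeval_apply]
    rw [hval, map_zero]
    apply hplane
    have hlin : eval v (map (algebraMap K L) (linForm a)) = v ⬝ᵥ (algebraMap K L ∘ a) := by
      simp [linForm, dotProduct, mul_comm]
    have hvec : (fun j => eval v (map (algebraMap K L) (φ j))) =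
        v - (v ⬝ᵥ (algebraMap K L ∘ a)) • Pi.single i (algebraMap K L (a i)⁻¹) := by
      funext j
      simp only [φ, map_sub, map_mul, map_X, eval_X, map_C, eval_C, hlin, Pi.sub_apply,
        Pi.smul_apply, smul_eq_mul, Pi.single_apply, apply_ite (algebraMap K L), map_zero]
      ring
    rw [hvec, sub_dotProduct, smul_dotProduct, single_dotProduct, Function.comp_apply, ← map_mul,
      inv_mul_cancel₀ hi, map_one, smul_eq_mul, mul_one, sub_self]
  refine hnoline ⟨a, ha, Ideal.mem_span_singleton.mp (Ideal.Quotient.eq_zero_iff_mem.mp ?_)⟩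
  have hmk : (Ideal.Quotient.mkₐ K (Ideal.span {linForm a})).comp (aeval φ) =
      Ideal.Quotient.mkₐ K (Ideal.span {linForm a}) := by
    refine MvPolynomial.algHom_ext fun j => ?_
    rw [AlgHom.comp_apply, aeval_X]
    refine Ideal.Quotient.eq.mpr ?_
    rw [sub_sub_cancel_left]
    exact neg_mem (Ideal.mul_mem_left _ _ (Ideal.mem_span_singleton_self _))
  have := DFunLike.congr_fun hmk G
  rw [AlgHom.comp_apply, hφ, map_zero] at this
  exact this.symm

lemma ncard_eval_algebraMap_eq_zero_le {f : Polynomial L} (hf : f ≠ 0) :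
    {t : K | f.eval (algebraMap K L t) = 0}.ncard ≤ f.natDegree := by
  classical
  rw [← Set.ncard_image_of_injective _ (algebraMap K L).injective]
  refine (Set.ncard_le_ncard (t := (f.roots.toFinset : Set L)) ?_ (Finset.finite_toSet _)).trans ?_
  · rintro _ ⟨t, ht, rfl⟩
    simpa [hf] using ht
  · rw [Set.ncard_coe_finset]
    exact (Multiset.toFinset_card_le _).trans (Polynomial.card_roots' f)

/-- The `K`-rational points of the curve with equation `F` over an extension `L` of `K`. -/
def rationalZeros (K : Type) [Field K] {L : Type*} [Field L] [Algebra K L]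
    (F : MvPolynomial (Fin 3) L) : Set (Projectivization K (Fin 3 → K)) :=
  {p | eval (algebraMap K L ∘ p.rep) F = 0}

lemma rationalZeros_map (L : Type*) [Field L] [Algebra K L] (G : MvPolynomial (Fin 3) K) :
    rationalZeros K (map (algebraMap K L) G) = {p | eval p.rep G = 0} := by
  ext p
  rw [rationalZeros, Set.mem_ofPred_eq, Set.mem_ofPred_eq, eval_algebraMap_comp_map, map_eq_zero]

lemma algebraMap_comp_add_smul {σ : Type*} (Q P : σ → K) (t : K) :
    algebraMap K L ∘ (Q + t • P) =
      algebraMap K L ∘ Q + algebraMap K L t • (algebraMap K L ∘ P) := by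
  funext i
  simp [Algebra.smul_def]

/-- Counting rational points on the lines through `P`. -/
lemma ncard_rationalZeros_le [Fintype K] {F : MvPolynomial (Fin 3) L} {d : ℕ}
    (hF : F.IsHomogeneous d)
    (hline : ∀ P Q : Fin 3 → K, LinearIndependent K ![P, Q] →
      lineRestrict (algebraMap K L ∘ P) (algebraMap K L ∘ Q) F ≠ 0)
    {P R : Fin 3 → K} (hPR : LinearIndependent K ![P, R]) {a b : ℕ}
    (ha : (lineRestrict (algebraMap K L ∘ P) (algebraMap K L ∘ R) F).natDegree ≤ a)
    (hb : ∀ Q : Fin 3 → K, LinearIndependent K ![P, Q] →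
      (lineRestrict (algebraMap K L ∘ P) (algebraMap K L ∘ Q) F).natDegree ≤ b) :
    (rationalZeros K F).ncard ≤ 1 + a + Fintype.card K * b := by
  classical
  obtain ⟨Q, hspan, hQ⟩ := exists_complement_of_linearIndependent_pair hPR
  let pt : (Fin 3 → K) → Projectivization K (Fin 3 → K) := fun v =>
    if h : v ≠ 0 then .mk K v h else .mk K P (hPR.ne_zero 0)
  have hpt : ∀ (p : Projectivization K (Fin 3 → K)) (v : Fin 3 → K) (c : K),
      p.rep = c • v → p ∈ rationalZeros K F → pt v = p ∧ eval (algebraMap K L ∘ v) F = 0 := by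
    intro p v c hc hp
    have hc0 : c ≠ 0 := fun h => p.rep_nonzero (by rw [hc, h, zero_smul])
    have hv0 : v ≠ 0 := fun h => p.rep_nonzero (by rw [hc, h, smul_zero])
    constructor
    · simp only [pt, dif_pos hv0]
      rw [← p.mk_rep, Projectivization.mk_eq_mk_iff']
      refine ⟨c⁻¹, ?_⟩
      rw [hc, smul_smul, inv_mul_cancel₀ hc0, one_smul]
    · have hrep : algebraMap K L ∘ p.rep = algebraMap K L c • (algebraMap K L ∘ v) := by
        rw [hc]; funext i; simp
      have hp' : eval (algebraMap K L ∘ p.rep) F = 0 := hp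
      rw [hrep, hF.eval_smul] at hp'
      exact (mul_eq_zero.mp hp').resolve_left (pow_ne_zero _ (by simpa using hc0))
  let Z : (Fin 3 → K) → Set K := fun S => {t | eval (algebraMap K L ∘ (S + t • P)) F = 0}
  have hZ : ∀ S, LinearIndependent K ![P, S] → (Z S).ncard ≤
      (lineRestrict (algebraMap K L ∘ P) (algebraMap K L ∘ S) F).natDegree := by
    intro S hS
    convert ncard_eval_algebraMap_eq_zero_le (hline P S hS) (K := K) using 3
    funext t
    rw [algebraMap_comp_add_smul, eval_lineRestrict]
  have hcover : rationalZeros K F ⊆ {pt P} ∪ (fun t => pt (R + t • P)) '' Z R ∪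
      ⋃ s : K, (fun t => pt (Q + s • R + t • P)) '' Z (Q + s • R) := by
    intro p hp
    obtain ⟨x, y, z, hxyz⟩ := hspan p.rep
    by_cases hx : x = 0
    · by_cases hy : y = 0
      · rw [hx, hy, zero_smul, zero_smul, zero_add, zero_add] at hxyz
        exact .inl (.inl (hpt p P z hxyz hp).1.symm)
      · rw [hx, zero_smul, zero_add] at hxyz
        have h := hpt p (R + (y⁻¹ * z) • P) y
          (by rw [hxyz, smul_add, smul_smul, mul_inv_cancel_left₀ hy]) hp
        exact .inl (.inr ⟨_, h.2, h.1⟩)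
    · have h := hpt p (Q + (x⁻¹ * y) • R + (x⁻¹ * z) • P) x
        (by rw [hxyz, smul_add, smul_add, smul_smul, smul_smul, mul_inv_cancel_left₀ hx,
          mul_inv_cancel_left₀ hx]) hp
      exact .inr (Set.mem_iUnion.mpr ⟨_, _, h.2, h.1⟩)
  have h1 : ((fun t => pt (R + t • P)) '' Z R).ncard ≤ a :=
    (Set.ncard_image_le (Set.toFinite _)).trans ((hZ R hPR).trans ha)
  have h2 : (⋃ s : K, (fun t => pt (Q + s • R + t • P)) '' Z (Q + s • R)).ncard ≤
      Fintype.card K * b := by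
    refine (Set.ncard_iUnion_le_of_fintype _).trans ?_
    refine (Finset.sum_le_card_nsmul _ _ b fun s _ => ?_).trans (by simp)
    exact (Set.ncard_image_le (Set.toFinite _)).trans ((hZ _ (hQ s)).trans (hb _ (hQ s)))
  have h3 := Set.ncard_le_ncard hcover
  have h4 := Set.ncard_union_le ({pt P} ∪ (fun t => pt (R + t • P)) '' Z R)
    (⋃ s : K, (fun t => pt (Q + s • R + t • P)) '' Z (Q + s • R))
  have h5 := Set.ncard_union_le {pt P} ((fun t => pt (R + t • P)) '' Z R)
  rw [Set.ncard_singleton] at h5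
  omega

end RationalPoints

section Tangents

variable {L : Type*} [Field L] [Algebra K L]

/-- The gradient of `F` at `P`. -/
noncomputable def gradientAt {σ L : Type*} [Field L] (F : MvPolynomial σ L) (P : σ → L) : σ → L :=
  fun i => eval P (pderiv i F)

lemma gradientAt_map {σ : Type*} (G : MvPolynomial σ K) (P : σ → K) :
    gradientAt (map (algebraMap K L) G) (algebraMap K L ∘ P) =
      algebraMap K L ∘ gradientAt G P := by
  funext i
  rw [gradientAt, pderiv_map, eval_algebraMap_comp_map]
  rfl

lemma algebraMap_comp_dotProduct_gradientAt_map {σ : Type*} [Fintype σ] (G : MvPolynomial σ K)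
    (P Q : σ → K) :
    (algebraMap K L ∘ Q) ⬝ᵥ gradientAt (map (algebraMap K L) G) (algebraMap K L ∘ P) =
      algebraMap K L (Q ⬝ᵥ gradientAt G P) := by
  rw [gradientAt_map, RingHom.map_dotProduct]

lemma dotProduct_gradientAt_self {σ : Type*} [Fintype σ] {G : MvPolynomial σ K} {d : ℕ}
    (hG : G.IsHomogeneous d) {P : σ → K} (hP : eval P G = 0) : P ⬝ᵥ gradientAt G P = 0 := by
  have := congrArg (eval P) hG.sum_X_mul_pderiv
  simpa [hP, dotProduct, gradientAt] using this

lemma ncard_rationalZeros_le_of_singular [Fintype K] [Infinite L]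
    {F : MvPolynomial (Fin 3) L} {d : ℕ}
    (hF : F.IsHomogeneous d)
    (hline : ∀ P Q : Fin 3 → K, LinearIndependent K ![P, Q] →
      lineRestrict (algebraMap K L ∘ P) (algebraMap K L ∘ Q) F ≠ 0)
    {P : Fin 3 → K} (hP0 : P ≠ 0) (hP : eval (algebraMap K L ∘ P) F = 0)
    (hsing : gradientAt F (algebraMap K L ∘ P) = 0) :
    2 ≤ d ∧ (rationalZeros K F).ncard ≤ 1 + (d - 2) + Fintype.card K * (d - 2) := by
  obtain ⟨R, -, hR⟩ := exists_linearIndependent_pair_dotProduct_eq_zero hP0 0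
  have hdeg : ∀ Q : Fin 3 → K, LinearIndependent K ![P, Q] →
      (lineRestrict (algebraMap K L ∘ P) (algebraMap K L ∘ Q) F).natDegree + 2 ≤ d := fun Q hQ =>
    natDegree_lineRestrict_add_two_le hF hP
      ((congrArg ((algebraMap K L ∘ Q) ⬝ᵥ ·) hsing).trans (dotProduct_zero _)) (hline P Q hQ)
  have := hdeg R hR
  exact ⟨by omega, ncard_rationalZeros_le hF hline hR (by omega) fun Q hQ => by
    have := hdeg Q hQ
    omega⟩

/-- A curve with a rational point whose tangent line is rational. -/
lemma ncard_rationalZeros_le_of_tangent [Fintype K] [Infinite L]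
    {F : MvPolynomial (Fin 3) L} {d : ℕ}
    (hF : F.IsHomogeneous d)
    (hline : ∀ P Q : Fin 3 → K, LinearIndependent K ![P, Q] →
      lineRestrict (algebraMap K L ∘ P) (algebraMap K L ∘ Q) F ≠ 0)
    {P : Fin 3 → K} (hP0 : P ≠ 0) (hP : eval (algebraMap K L ∘ P) F = 0) (w : Fin 3 → K)
    (htan : ∀ R, R ⬝ᵥ w = 0 →
      (algebraMap K L ∘ R) ⬝ᵥ gradientAt F (algebraMap K L ∘ P) = 0) :
    2 ≤ d ∧ (rationalZeros K F).ncard ≤ 1 + (d - 2) + Fintype.card K * (d - 1) := by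
  obtain ⟨R, hRw, hR⟩ := exists_linearIndependent_pair_dotProduct_eq_zero hP0 w
  have := natDegree_lineRestrict_add_two_le hF hP (htan R hRw) (hline P R hR)
  exact ⟨by omega, ncard_rationalZeros_le hF hline hR (by omega) fun Q hQ => by
    have := natDegree_lineRestrict_lt hF hP (hline P Q hQ)
    omega⟩

end Tangents

section PlaneFilling

variable [Fintype K] {G : MvPolynomial (Fin 3) K}

/-- A line is tangent to a plane-filling curve of degree `q + 2` at no more than one point. -/
lemma not_tangent_at_two_points (hG : G.IsHomogeneous (Fintype.card K + 2))
    (hnoline : ¬ ∃ a : Fin 3 → K, a ≠ 0 ∧ linForm a ∣ G) (hall : ∀ v, eval v G = 0)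
    {P Q : Fin 3 → K} (hPQ : LinearIndependent K ![P, Q])
    (hP : Q ⬝ᵥ gradientAt G P = 0) (hQ : P ⬝ᵥ gradientAt G Q = 0) : False := by
  classical
  have h0 := lineRestrict_map_ne_zero (L := AlgebraicClosure K) hG hnoline hPQ
  have hdeg := natDegree_lineRestrict_add_two_le (hG.map (algebraMap K (AlgebraicClosure K)))
    (by rw [eval_algebraMap_comp_map, hall, map_zero])
    ((algebraMap_comp_dotProduct_gradientAt_map G P Q).trans (by rw [hP, map_zero])) h0
  set f := lineRestrict (algebraMap K (AlgebraicClosure K) ∘ P)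
    (algebraMap K (AlgebraicClosure K) ∘ Q) (map (algebraMap K (AlgebraicClosure K)) G) with hf
  have hroot : ∀ t : K, f.eval (algebraMap K (AlgebraicClosure K) t) = 0 := fun t => by
    rw [hf, eval_lineRestrict, ← algebraMap_comp_add_smul, eval_algebraMap_comp_map, hall, map_zero]
  have hX : Polynomial.X ^ 2 ∣ f := Polynomial.X_pow_dvd_iff.mpr fun n hn => by
    interval_cases n
    · rw [hf, coeff_zero_lineRestrict, eval_algebraMap_comp_map, hall, map_zero]
    · rw [hf, coeff_one_lineRestrict]
      exact (algebraMap_comp_dotProduct_gradientAt_map G Q P).trans (by rw [hQ, map_zero])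
  obtain ⟨g, hg⟩ := hX
  have hg0 : g ≠ 0 := right_ne_zero_of_mul (hg ▸ h0)
  have hfg : f.natDegree = 2 + g.natDegree := by
    rw [hg, Polynomial.natDegree_mul (pow_ne_zero 2 Polynomial.X_ne_zero) hg0,
      Polynomial.natDegree_X_pow]
  refine hg0 (Polynomial.eq_zero_of_natDegree_lt_card_of_eval_eq_zero g (ι := Kˣ)
    (f := fun u => algebraMap K (AlgebraicClosure K) u)
    ((algebraMap K (AlgebraicClosure K)).injective.comp Units.val_injective) (fun u => ?_) ?_)
  · have h := hroot u
    rw [hg, Polynomial.eval_mul, Polynomial.eval_pow, Polynomial.eval_X] at h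
    exact (mul_eq_zero.mp h).resolve_left (pow_ne_zero _ ((map_ne_zero _).mpr u.ne_zero))
  · rw [Fintype.card_units]
    omega

lemma gradientAt_ne_zero_of_plane_filling (hG : G.IsHomogeneous (Fintype.card K + 2))
    (hnoline : ¬ ∃ a : Fin 3 → K, a ≠ 0 ∧ linForm a ∣ G) (hall : ∀ v, eval v G = 0)
    (p : Projectivization K (Fin 3 → K)) : gradientAt G p.rep ≠ 0 := by
  intro hsing
  have hmk : ∀ w : Fin 3 → K, w ≠ 0 → ∃ a : Projectivization K (Fin 3 → K), ∃ c : K, c ≠ 0 ∧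
      a.rep = c • w := fun w hw => by
    obtain ⟨c, hc⟩ := Projectivization.exists_smul_eq_mk_rep K w hw
    exact ⟨_, c, c.ne_zero, hc.symm⟩
  have htangent : ∀ p : Projectivization K (Fin 3 → K), ∃ a : Projectivization K (Fin 3 → K),
      p.rep ⬝ᵥ a.rep = 0 ∧ ∀ x, x ⬝ᵥ a.rep = 0 → x ⬝ᵥ gradientAt G p.rep = 0 := by
    intro p
    by_cases hg : gradientAt G p.rep = 0
    · obtain ⟨R, hR, hind⟩ := exists_linearIndependent_pair_dotProduct_eq_zero p.rep_nonzero p.rep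
      obtain ⟨a, c, -, ha⟩ := hmk R (hind.ne_zero 1)
      exact ⟨a, by rw [ha, dotProduct_smul, dotProduct_comm, hR, smul_zero],
        fun x _ => by rw [hg, dotProduct_zero]⟩
    · obtain ⟨a, c, hc, ha⟩ := hmk _ hg
      refine ⟨a, by rw [ha, dotProduct_smul, dotProduct_gradientAt_self hG (hall _), smul_zero],
        fun x hx => ?_⟩
      rw [ha, dotProduct_smul, smul_eq_mul] at hx
      exact (mul_eq_zero.mp hx).resolve_left hc
  choose τ hτ hτ' using htangent
  have hinj : Function.Injective τ := fun p q hpq => by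
    by_contra hne
    exact not_tangent_at_two_points hG hnoline hall
      (Projectivization.linearIndependent_pair_iff_ne.mpr hne)
      (hτ' p _ (hpq ▸ hτ q)) (hτ' q _ (hpq ▸ hτ p))
  obtain ⟨R, hR, hind⟩ := exists_linearIndependent_pair_dotProduct_eq_zero (τ p).rep_nonzero p.rep
  obtain ⟨a, c, -, ha⟩ := hmk R (hind.ne_zero 1)
  obtain ⟨q, rfl⟩ := Finite.surjective_of_injective hinj a
  have hpq : p ≠ q := by
    rintro rfl
    exact one_ne_zero (LinearIndependent.pair_iff.mp hind 1 (-c)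
      (by rw [one_smul, neg_smul, ← ha, add_neg_cancel])).1
  exact not_tangent_at_two_points hG hnoline hall
    (Projectivization.linearIndependent_pair_iff_ne.mpr hpq)
    (by rw [hsing, dotProduct_zero])
    (hτ' q _ (by rw [ha, dotProduct_smul, dotProduct_comm, hR, smul_zero]))

end PlaneFilling

section ExtremalCurve

variable [Fintype K] {G : MvPolynomial (Fin 3) K} {d : ℕ}

lemma card_projectivization_fin_three (K : Type) [Field K] [Fintype K] :
    Nat.card (Projectivization K (Fin 3 → K)) = Fintype.card K ^ 2 + Fintype.card K + 1 := by
  rw [Projectivization.card_of_finrank K (Fin 3 → K) (Module.finrank_fin_fun K),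
    Nat.card_eq_fintype_card]
  simp [Finset.sum_range_succ]
  ring

lemma gradientAt_ne_zero_of_extremal (hG : G.IsHomogeneous d)
    (hnoline : ¬ ∃ a : Fin 3 → K, a ≠ 0 ∧ linForm a ∣ G)
    (hN : {p : Projectivization K (Fin 3 → K) | eval p.rep G = 0}.ncard =
      (d - 1) * Fintype.card K + 1)
    {p : Projectivization K (Fin 3 → K)} (hp : eval p.rep G = 0) :
    gradientAt G p.rep ≠ 0 := by
  intro hsing
  have hq := Fintype.card_pos (α := K)
  have hcard := Set.ncard_le_card {p : Projectivization K (Fin 3 → K) | eval p.rep G = 0}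
  rw [card_projectivization_fin_three] at hcard
  obtain ⟨h2, hle⟩ := ncard_rationalZeros_le_of_singular
    (hG.map (algebraMap K (AlgebraicClosure K)))
    (fun P Q hPQ => lineRestrict_map_ne_zero hG hnoline hPQ) p.rep_nonzero
    (by rw [eval_algebraMap_comp_map, hp, map_zero])
    (by rw [gradientAt_map, hsing]; funext i; simp)
  rw [rationalZeros_map, hN] at hle
  rw [hN] at hcard
  obtain ⟨e, rfl⟩ := Nat.exists_eq_add_of_le' h2
  have he : e = Fintype.card K := by
    simp only [Nat.add_sub_cancel, show e + 2 - 1 = e + 1 by omega] at hle hcard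
    apply le_antisymm
    · by_contra! hlt
      nlinarith
    · nlinarith
  subst he
  have huniv : {p : Projectivization K (Fin 3 → K) | eval p.rep G = 0} = Set.univ := by
    rw [Set.eq_univ_iff_ncard, hN, card_projectivization_fin_three,
      show Fintype.card K + 2 - 1 = Fintype.card K + 1 by omega]
    ring
  refine gradientAt_ne_zero_of_plane_filling hG hnoline (fun v => ?_) p hsing
  by_cases hv : v = 0
  · rw [hv, ← zero_smul K (0 : Fin 3 → K), hG.eval_smul, zero_pow (by omega), zero_mul]
  · obtain ⟨c, hc⟩ := Projectivization.exists_smul_eq_mk_rep K v hv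
    have hmem : eval (Projectivization.mk K v hv).rep G = 0 :=
      (huniv ▸ Set.mem_univ _ : Projectivization.mk K v hv ∈ {p | eval p.rep G = 0})
    rw [← hc, Units.smul_def, hG.eval_smul] at hmem
    exact (mul_eq_zero.mp hmem).resolve_left (pow_ne_zero _ c.ne_zero)

/-- A factor of the equation has at most as many points as a curve smooth at its rational points. -/
lemma ncard_rationalZeros_factor_le {L : Type*} [Field L] [Algebra K L] [Infinite L]
    (hG : G.IsHomogeneous d) (hnoline : ¬ ∃ a : Fin 3 → K, a ≠ 0 ∧ linForm a ∣ G)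
    (hsmooth : ∀ p : Projectivization K (Fin 3 → K), eval p.rep G = 0 → gradientAt G p.rep ≠ 0)
    {A B : MvPolynomial (Fin 3) L} (hAB : map (algebraMap K L) G = A * B) {e : ℕ}
    (hA : A.IsHomogeneous e) :
    (rationalZeros K A).ncard ≤ (Fintype.card K + 1) * (e - 1) := by
  obtain hempty | ⟨p, hp⟩ := (rationalZeros K A).eq_empty_or_nonempty
  · simp [hempty]
  have hpA : eval (algebraMap K L ∘ p.rep) A = 0 := hp
  have hgrad : gradientAt (map (algebraMap K L) G) (algebraMap K L ∘ p.rep) =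
      eval (algebraMap K L ∘ p.rep) B • gradientAt A (algebraMap K L ∘ p.rep) := by
    funext i
    simp [gradientAt, hAB, hpA]
  have hpG : eval p.rep G = 0 := by
    apply (algebraMap K L).injective
    rw [← eval_algebraMap_comp_map, hAB, map_mul, hpA, zero_mul, map_zero]
  have hB : eval (algebraMap K L ∘ p.rep) B ≠ 0 := fun hB => hsmooth p hpG <| by
    rw [hB, zero_smul, gradientAt_map] at hgrad
    funext i
    exact (algebraMap K L).injective ((congrFun hgrad i).trans (map_zero _).symm)
  obtain ⟨h2, hle⟩ := ncard_rationalZeros_le_of_tangent hA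
    (fun P Q hPQ h0 => lineRestrict_map_ne_zero (L := L) hG hnoline hPQ (by
      rw [hAB, map_mul, h0, zero_mul])) p.rep_nonzero hpA (gradientAt G p.rep) fun R hR => by
        have h := algebraMap_comp_dotProduct_gradientAt_map (L := L) G p.rep R
        rw [hR, map_zero, hgrad, dotProduct_smul, smul_eq_mul] at h
        exact (mul_eq_zero.mp h).resolve_left hB
  obtain ⟨e, rfl⟩ := Nat.exists_eq_add_of_le' h2
  simp only [Nat.add_sub_cancel, show e + 2 - 1 = e + 1 by omega] at hle ⊢
  linarith

lemma MvPolynomial.IsHomogeneous.pos_of_not_isUnit {σ L : Type*} [Field L] {A : MvPolynomial σ L}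
    {e : ℕ} (hA : A.IsHomogeneous e) (h0 : A ≠ 0) (hu : ¬ IsUnit A) : 1 ≤ e := by
  rw [Nat.one_le_iff_ne_zero]
  rintro rfl
  have hC := totalDegree_eq_zero_iff_eq_C.mp (hA.totalDegree h0)
  rw [hC] at hu h0
  exact hu ((isUnit_iff_ne_zero.mpr fun h => h0 (by rw [h, C_0])).map C)

lemma irreducible_map_of_extremal {L : Type*} [Field L] [Algebra K L] [Infinite L]
    (hG : G.IsHomogeneous d) (hnoline : ¬ ∃ a : Fin 3 → K, a ≠ 0 ∧ linForm a ∣ G)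
    (hN : {p : Projectivization K (Fin 3 → K) | eval p.rep G = 0}.ncard =
      (d - 1) * Fintype.card K + 1) :
    Irreducible (map (algebraMap K L) G) := by
  have hF0 : map (algebraMap K L) G ≠ 0 := fun h => hnoline ⟨1, one_ne_zero, by
    rw [map_injective _ (algebraMap K L).injective (h.trans (map_zero _).symm)]
    exact dvd_zero _⟩
  have hF := hG.map (algebraMap K L)
  refine ⟨fun hunit => ?_, fun A B hAB => ?_⟩
  · obtain ⟨p, hp⟩ := Set.nonempty_of_ncard_ne_zero (hN.trans_ne (Nat.succ_ne_zero _))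
    have h := hunit.map (eval (algebraMap K L ∘ p.rep))
    rw [eval_algebraMap_comp_map, show eval p.rep G = 0 from hp, map_zero] at h
    exact not_isUnit_zero h
  · by_contra! hu
    have hAB0 : A * B ≠ 0 := hAB ▸ hF0
    obtain ⟨e₁, hA⟩ := IsHomogeneous.of_mul_left (hAB ▸ hF) hAB0
    obtain ⟨e₂, hB⟩ := IsHomogeneous.of_mul_left (A := B) (B := A) (mul_comm A B ▸ hAB ▸ hF)
      (mul_comm A B ▸ hAB0)
    have hd : d = e₁ + e₂ := hF.inj_right (hAB ▸ hA.mul hB) hF0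
    have h₁ := hA.pos_of_not_isUnit (left_ne_zero_of_mul hAB0) hu.1
    have h₂ := hB.pos_of_not_isUnit (right_ne_zero_of_mul hAB0) hu.2
    have hsmooth := fun p hp => gradientAt_ne_zero_of_extremal hG hnoline hN (p := p) hp
    have hcA := ncard_rationalZeros_factor_le hG hnoline hsmooth hAB hA
    have hcB := ncard_rationalZeros_factor_le hG hnoline hsmooth (hAB.trans (mul_comm A B)) hB
    have hunion : {p : Projectivization K (Fin 3 → K) | eval p.rep G = 0} ⊆
        rationalZeros K A ∪ rationalZeros K B := by
      rw [← rationalZeros_map L]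
      intro p hp
      rw [rationalZeros, Set.mem_ofPred_eq, hAB, map_mul] at hp
      exact mul_eq_zero.mp hp
    have hle := (Set.ncard_le_ncard hunion).trans (Set.ncard_union_le _ _)
    have hcard := Set.ncard_le_card {p : Projectivization K (Fin 3 → K) | eval p.rep G = 0}
    rw [card_projectivization_fin_three] at hcard
    rw [hN] at hle hcard
    have hq := Fintype.card_pos (α := K)
    obtain ⟨a, rfl⟩ := Nat.exists_eq_add_of_le' h₁
    obtain ⟨b, rfl⟩ := Nat.exists_eq_add_of_le' h₂
    rw [hd] at hle hcard
    simp only [Nat.add_sub_cancel, show a + 1 + (b + 1) - 1 = a + b + 1 by omega] at *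
    have hab : a + b ≤ Fintype.card K := by
      by_contra! hlt
      nlinarith
    nlinarith

end ExtremalCurve

/-- A plane curve of degree `d` over `F_q` without `F_q`-line components
attaining the Sziklai bound `N_q(C) = (d-1)q + 1` is absolutely irreducible, and no
`F_q`-point of `C` is a singular point of `C`. -/
theorem extremal_curve_irreducible_and_smooth_at_rational_points
    (K : Type) [Field K] [Fintype K]
    (d : ℕ) (G : MvPolynomial (Fin 3) K)
    (hhom : G.IsHomogeneous d) (hsf : Squarefree G)
    (hnoline : ¬ ∃ a : Fin 3 → K, a ≠ 0 ∧ linForm a ∣ G)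
    (hN : Nat.card {p : Projectivization K (Fin 3 → K) // MvPolynomial.eval p.rep G = 0} =
      (d - 1) * Fintype.card K + 1) :
    Irreducible (MvPolynomial.map (algebraMap K (AlgebraicClosure K)) G) ∧
    ∀ p : Projectivization K (Fin 3 → K), MvPolynomial.eval p.rep G = 0 →
      ∃ i, MvPolynomial.eval p.rep (MvPolynomial.pderiv i G) ≠ 0 := by
  have hN' : {p : Projectivization K (Fin 3 → K) | eval p.rep G = 0}.ncard =
      (d - 1) * Fintype.card K + 1 := hN
  refine ⟨irreducible_map_of_extremal hhom hnoline hN', fun p hp => ?_⟩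
  exact Function.ne_iff.mp (gradientAt_ne_zero_of_extremal hhom hnoline hN' hp)
end

section
/- Let C be a plane curve of degree d over F_q without F_q-line components such that N_q(C) = (d-1)q + 1. Then d = 2 or √q + 1 ≤ d ≤ q + 2. -/
open MvPolynomial

variable {K : Type} [Field K]

/-- The homogeneous linear polynomial attached to a linear functional. -/
noncomputable def functionalForm {n : ℕ} (f : (Fin n → K) →ₗ[K] K) : MvPolynomial (Fin n) K :=
  linForm fun i => f (Pi.single i 1)

/-- Restriction of a polynomial to the parametrized line `y ↦ u + y p`. -/
noncomputable def restrictLine {n : ℕ} (u p : Fin n → K) :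
    MvPolynomial (Fin n) K →ₐ[K] Polynomial K :=
  aeval fun i => Polynomial.C (u i) + Polynomial.C (p i) * Polynomial.X

theorem isHomogeneous_linForm {n : ℕ} (a : Fin n → K) : (linForm a).IsHomogeneous 1 := by
  refine IsHomogeneous.sum _ _ _ fun i _ => ?_
  exact isHomogeneous_C_mul_X _ _

theorem eval_functionalForm {n : ℕ} (f : (Fin n → K) →ₗ[K] K) (v : Fin n → K) :
    eval v (functionalForm f) = f v := by
  conv_rhs => rw [← Finset.univ_sum_single v]
  simp only [functionalForm, linForm, map_sum, map_mul, eval_C, eval_X]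
  refine Finset.sum_congr rfl fun i _ => ?_
  have : (Pi.single i (v i) : Fin n → K) = v i • Pi.single i 1 := by
    rw [← Pi.single_smul]; simp
  rw [this, map_smul, smul_eq_mul, mul_comm]

theorem restrictLine_functionalForm {n : ℕ} (u p : Fin n → K) (f : (Fin n → K) →ₗ[K] K) :
    restrictLine u p (functionalForm f) =
      Polynomial.C (f u) + Polynomial.C (f p) * Polynomial.X := by
  rw [← eval_functionalForm f u, ← eval_functionalForm f p]
  simp only [functionalForm, linForm, restrictLine, map_sum, map_mul, aeval_X, eval_C, eval_X,
    algHom_C, Finset.sum_mul, ← Finset.sum_add_distrib, Polynomial.algebraMap_eq]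
  refine Finset.sum_congr rfl fun i _ => ?_
  ring

theorem eval_restrictLine {n : ℕ} (u p : Fin n → K) (y : K) (f : MvPolynomial (Fin n) K) :
    (restrictLine u p f).eval y = eval (u + y • p) f := by
  induction f using MvPolynomial.induction_on with
  | C a => simp [restrictLine]
  | add f g hf hg => simp [hf, hg]
  | mul_X f i hf => rw [map_mul, Polynomial.eval_mul, hf]; simp [restrictLine, mul_comm (p i)]

theorem exists_isHomogeneous_restrictLine_eq {n : ℕ} {u p : Fin n → K}
    (h : LinearIndependent K ![u, p]) (m : ℕ) (r : Polynomial K) (hr : r.natDegree ≤ m) :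
    ∃ f : MvPolynomial (Fin n) K, f.IsHomogeneous m ∧ restrictLine u p f = r := by
  have key : ∀ c : Fin 2 → K, ∃ f : (Fin n → K) →ₗ[K] K, f u = c 0 ∧ f p = c 1 := by
    intro c
    obtain ⟨f, hf⟩ := LinearMap.exists_extend ((Module.Basis.span h).constr K c)
    have hv : ∀ i, f (![u, p] i) = c i := fun i => by
      rw [← (Module.Basis.span h).constr_basis K c i, ← hf, LinearMap.comp_apply,
        Submodule.subtype_apply, Module.Basis.span_apply]
    exact ⟨f, hv 0, hv 1⟩
  obtain ⟨f, hfu, hfp⟩ := key ![1, 0]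
  obtain ⟨g, hgu, hgp⟩ := key ![0, 1]
  refine ⟨∑ k ∈ Finset.range (m + 1),
    C (r.coeff k) * (functionalForm f ^ (m - k) * functionalForm g ^ k), ?_, ?_⟩
  · refine IsHomogeneous.sum _ _ _ fun k hk => ?_
    refine IsHomogeneous.C_mul ?_ _
    have hk' : 1 * (m - k) + 1 * k = m := by
      have := Finset.mem_range.1 hk
      omega
    have := ((isHomogeneous_linForm fun i => f (Pi.single i 1)).pow (m - k)).mul
      ((isHomogeneous_linForm fun i => g (Pi.single i 1)).pow k)
    rwa [hk'] at this
  · simp only [map_sum, map_mul, map_pow, restrictLine_functionalForm, hfu, hfp, hgu, hgp,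
      algHom_C, Polynomial.algebraMap_eq]
    simp only [Matrix.cons_val_zero, Matrix.cons_val_one, map_zero, map_one,
      zero_mul, add_zero, one_pow, one_mul, zero_add]
    exact (r.as_sum_range_C_mul_X_pow' (by omega)).symm

theorem finrank_homogeneousSubmodule_fin_three (n : ℕ) :
    Module.finrank K (homogeneousSubmodule (Fin 3) K n) = (n + 2).choose 2 := by
  have hset : {d : Fin 3 →₀ ℕ | d.degree = n} =
      ((Finset.univ : Finset (Fin 3)).finsuppAntidiag n : Set (Fin 3 →₀ ℕ)) := by
    ext d
    simp [Finset.mem_finsuppAntidiag, Finsupp.degree_eq_sum]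
  rw [homogeneousSubmodule_eq_finsupp_supported,
    (AddMonoidAlgebra.supportedEquivFinsupp (R := K) (S := K) _).finrank_eq, hset]
  simp only [Finset.coe_sort_coe, Module.finrank_finsupp_self, Fintype.card_coe,
    Finset.card_finsuppAntidiag_nat_eq_choose, Finset.card_univ, Fintype.card_fin]
  rw [show 3 + n - 1 = n + 2 by omega]
  exact Nat.choose_symm_add

instance (n : ℕ) : Module.Finite K (homogeneousSubmodule (Fin 3) K n) :=
  Module.Finite.iff_fg.2 (homogeneousSubmodule_fg _ _ n)

theorem choose_two_add_choose_two (a b c : ℕ) :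
    (a + b + c + 2).choose 2 + (c + 2).choose 2 =
      (b + c + 2).choose 2 + (a + c + 2).choose 2 + a * b := by
  have h : ∀ k : ℕ, 2 * (k + 2).choose 2 = (k + 2) * (k + 1) := fun k => by
    rw [Nat.choose_two_right, Nat.mul_div_cancel' (Nat.even_mul_pred_self _).two_dvd]
    rfl
  have h1 := h (a + b + c)
  have h2 := h c
  have h3 := h (b + c)
  have h4 := h (a + c)
  nlinarith

/-- The substitution `X i ↦ t X i`, which records the homogeneous components of a polynomial as the
coefficients of the powers of `t`. -/
noncomputable def gradingHom (σ : Type*) :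
    MvPolynomial σ K →ₐ[K] Polynomial (MvPolynomial σ K) :=
  aeval fun i => Polynomial.C (X i) * Polynomial.X

theorem gradingHom_monomial {σ : Type*} (m : σ →₀ ℕ) (a : K) :
    gradingHom σ (monomial m a) = Polynomial.C (monomial m a) * Polynomial.X ^ m.degree := by
  rw [gradingHom, aeval_monomial, monomial_eq, map_mul, mul_assoc]
  congr 1
  simp only [Finsupp.prod, mul_pow, Finset.prod_mul_distrib, map_prod, map_pow,
    Finset.prod_pow_eq_pow_sum]
  rfl

theorem coeff_gradingHom {σ : Type*} (f : MvPolynomial σ K) (k : ℕ) :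
    (gradingHom σ f).coeff k = homogeneousComponent k f := by
  classical
  induction f using MvPolynomial.induction_on' with
  | monomial m a =>
    rw [gradingHom_monomial, Polynomial.coeff_C_mul_X_pow,
      homogeneousComponent_of_mem (isHomogeneous_monomial a rfl)]
  | add p q hp hq => simp [hp, hq]

theorem gradingHom_of_isHomogeneous {σ : Type*} {f : MvPolynomial σ K} {n : ℕ}
    (hf : f.IsHomogeneous n) : gradingHom σ f = Polynomial.C f * Polynomial.X ^ n := by
  classical
  ext1 k
  rw [coeff_gradingHom, Polynomial.coeff_C_mul_X_pow, homogeneousComponent_of_mem hf]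

theorem MvPolynomial.IsHomogeneous.exists_of_mul {σ : Type*} {A B : MvPolynomial σ K} {n : ℕ}
    (h : (A * B).IsHomogeneous n) (h0 : A * B ≠ 0) : ∃ a, A.IsHomogeneous a := by
  have hinj : ∀ f : MvPolynomial σ K, f ≠ 0 → gradingHom σ f ≠ 0 := by
    intro f hf h
    refine hf ?_
    rw [← sum_homogeneousComponent f]
    refine Finset.sum_eq_zero fun k _ => ?_
    rw [← coeff_gradingHom, h, Polynomial.coeff_zero]
  have hA := hinj A (left_ne_zero_of_mul h0)
  have hB := hinj B (right_ne_zero_of_mul h0)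
  have hAB := gradingHom_of_isHomogeneous h
  rw [map_mul] at hAB
  have h1 := Polynomial.natDegree_mul hA hB
  have h2 := Polynomial.natTrailingDegree_mul hA hB
  have h3 := Polynomial.natTrailingDegree_le_natDegree (gradingHom σ A)
  have h4 := Polynomial.natTrailingDegree_le_natDegree (gradingHom σ B)
  rw [hAB, Polynomial.natDegree_C_mul_X_pow _ _ h0] at h1
  rw [hAB, Polynomial.C_mul_X_pow_eq_monomial, Polynomial.natTrailingDegree_monomial h0] at h2
  refine ⟨(gradingHom σ A).natDegree, ?_⟩
  suffices h : (∑ k ∈ Finset.range (A.totalDegree + 1), homogeneousComponent k A).IsHomogeneous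
      (gradingHom σ A).natDegree by rwa [sum_homogeneousComponent] at h
  refine IsHomogeneous.sum _ _ _ fun k _ => ?_
  rcases lt_trichotomy k (gradingHom σ A).natDegree with hk | rfl | hk
  · rw [← coeff_gradingHom, Polynomial.coeff_eq_zero_of_lt_natTrailingDegree (by omega)]
    exact isHomogeneous_zero _ _ _
  · exact homogeneousComponent_isHomogeneous _ _
  · rw [← coeff_gradingHom, Polynomial.coeff_eq_zero_of_natDegree_lt hk]
    exact isHomogeneous_zero _ _ _

theorem MvPolynomial.IsHomogeneous.of_mul_left_s9 {σ : Type*} {A T : MvPolynomial σ K} {a t : ℕ}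
    (hA : A.IsHomogeneous a) (hA0 : A ≠ 0) (h : (A * T).IsHomogeneous (a + t)) :
    T.IsHomogeneous t := by
  rcases eq_or_ne T 0 with rfl | hT
  · exact isHomogeneous_zero _ _ _
  have h0 := mul_ne_zero hA0 hT
  have h' : (T * A).IsHomogeneous (a + t) := mul_comm A T ▸ h
  obtain ⟨s, hs⟩ := h'.exists_of_mul (mul_comm A T ▸ h0)
  obtain rfl : s = t := Nat.add_left_cancel ((hA.mul hs).inj_right h h0)
  exact hs

/-- The multiples of `A` by forms of degree `m`. -/
noncomputable def homogeneousMultiples (A : MvPolynomial (Fin 3) K) (m : ℕ) :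
    Submodule K (MvPolynomial (Fin 3) K) :=
  (homogeneousSubmodule (Fin 3) K m).map (LinearMap.mulLeft K A)

theorem finrank_homogeneousMultiples {A : MvPolynomial (Fin 3) K} (hA : A ≠ 0) (m : ℕ) :
    Module.finrank K (homogeneousMultiples A m) = (m + 2).choose 2 := by
  rw [← finrank_homogeneousSubmodule_fin_three (K := K) m]
  exact (Submodule.equivMapOfInjective _ (mul_right_injective₀ hA) _).finrank_eq.symm

instance (A : MvPolynomial (Fin 3) K) (m : ℕ) : Module.Finite K (homogeneousMultiples A m) :=
  Module.Finite.map _ _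

theorem homogeneousMultiples_le {A : MvPolynomial (Fin 3) K} {a : ℕ} (hA : A.IsHomogeneous a)
    (m : ℕ) : homogeneousMultiples A m ≤ homogeneousSubmodule (Fin 3) K (a + m) := by
  rintro _ ⟨f, hf, rfl⟩
  exact hA.mul hf

/-- The weak form of Bézout's theorem: two coprime plane curves of degrees `a` and `b` impose
codimension at most `a * b` on forms of large degree. -/
theorem finrank_le_mul_of_isRelPrime {A B : MvPolynomial (Fin 3) K} {a b : ℕ}
    (hA : A.IsHomogeneous a) (hB : B.IsHomogeneous b) (hA0 : A ≠ 0) (hB0 : B ≠ 0)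
    (hAB : IsRelPrime A B) {W : Type*} [AddCommGroup W] [Module K W] [Module.Finite K W]
    (φ : MvPolynomial (Fin 3) K →ₗ[K] W) (hφA : ∀ f, φ (A * f) = 0) (hφB : ∀ f, φ (B * f) = 0)
    (c : ℕ) (hsurj : ∀ w, ∃ f : MvPolynomial (Fin 3) K, f.IsHomogeneous (a + b + c) ∧ φ f = w) :
    Module.finrank K W ≤ a * b := by
  set V := homogeneousSubmodule (Fin 3) K (a + b + c)
  set MA := homogeneousMultiples A (b + c)
  set MB := homogeneousMultiples B (a + c)
  have hMA : MA ≤ V := by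
    have := homogeneousMultiples_le hA (b + c)
    rwa [← add_assoc] at this
  have hMB : MB ≤ V := by
    have := homogeneousMultiples_le hB (a + c)
    rwa [← add_assoc, add_comm b a] at this
  have hinf : MA ⊓ MB ≤ homogeneousMultiples (A * B) c := by
    rintro _ ⟨⟨f, hf, rfl⟩, ⟨g, hg, hfg⟩⟩
    simp only [LinearMap.mulLeft_apply] at hfg ⊢
    obtain ⟨t, rfl⟩ : B ∣ f := hAB.symm.dvd_of_dvd_mul_left ⟨g, hfg.symm⟩
    exact ⟨t, hB.of_mul_left_s9 hB0 hf, mul_assoc _ _ _⟩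
  have hker : MA ⊔ MB ≤ V ⊓ LinearMap.ker φ := by
    refine sup_le (le_inf hMA ?_) (le_inf hMB ?_)
    · rintro _ ⟨f, -, rfl⟩
      exact hφA f
    · rintro _ ⟨f, -, rfl⟩
      exact hφB f
  have hrange : Module.finrank K W + Module.finrank K (V ⊓ LinearMap.ker φ : Submodule K _) =
      (a + b + c + 2).choose 2 := by
    have h1 := (φ.domRestrict V).finrank_range_add_finrank_ker
    have h2 : LinearMap.range (φ.domRestrict V) = ⊤ := by
      rw [LinearMap.range_eq_top]
      intro w
      obtain ⟨f, hf, rfl⟩ := hsurj w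
      exact ⟨⟨f, hf⟩, rfl⟩
    rw [h2, finrank_top, finrank_homogeneousSubmodule_fin_three, LinearMap.ker_domRestrict] at h1
    rw [← h1, ← Submodule.map_comap_subtype]
    congr 1
    exact ((LinearMap.ker φ).submoduleOf V).equivMapOfInjective _
      (Submodule.injective_subtype _) |>.finrank_eq.symm
  have hsup := Submodule.finrank_sup_add_finrank_inf_eq MA MB
  rw [finrank_homogeneousMultiples hA0, finrank_homogeneousMultiples hB0] at hsup
  have : Module.Finite K (V ⊓ LinearMap.ker φ : Submodule K _) :=
    Submodule.finiteDimensional_of_le (S₂ := V) inf_le_left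
  have h3 := Submodule.finrank_mono hker
  have h4 := Submodule.finrank_mono hinf
  rw [finrank_homogeneousMultiples (mul_ne_zero hA0 hB0)] at h4
  have h5 := choose_two_add_choose_two a b c
  omega

/-- Bézout's inequality, where the intersection multiplicities are bounded below along pairwise
separated lines `y ↦ u i + y (p i)` by the degree of a common divisor `e i` of the restrictions. -/
theorem sum_natDegree_le_mul {ι : Type*} [Fintype ι] [DecidableEq ι] {A B : MvPolynomial (Fin 3) K}
    {a b : ℕ} (hA : A.IsHomogeneous a) (hB : B.IsHomogeneous b) (hA0 : A ≠ 0) (hB0 : B ≠ 0)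
    (hAB : IsRelPrime A B) (u p : ι → Fin 3 → K) (e : ι → Polynomial K) (he : ∀ i, e i ≠ 0)
    (hup : ∀ i, LinearIndependent K ![u i, p i])
    (heA : ∀ i, e i ∣ restrictLine (u i) (p i) A) (heB : ∀ i, e i ∣ restrictLine (u i) (p i) B)
    (hsep : ∀ i j, i ≠ j → ∃ s : MvPolynomial (Fin 3) K, s.IsHomogeneous 2 ∧
      e i ∣ restrictLine (u i) (p i) s ∧ IsCoprime (restrictLine (u j) (p j) s) (e j)) :
    ∑ i, (e i).natDegree ≤ a * b := by
  let φ : MvPolynomial (Fin 3) K →ₐ[K] ((i : ι) → Polynomial K ⧸ Ideal.span {e i}) :=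
    AlgHom.pi fun i => (Ideal.Quotient.mkₐ K (Ideal.span {e i})).comp
      (restrictLine (u i) (p i))
  have hφ : ∀ f i, φ f i = Ideal.Quotient.mk (Ideal.span {e i}) (restrictLine (u i) (p i) f) :=
    fun f i => rfl
  have hφ0 : ∀ f i, φ f i = 0 ↔ e i ∣ restrictLine (u i) (p i) f := fun f i => by
    rw [hφ, Ideal.Quotient.eq_zero_iff_mem, Ideal.mem_span_singleton]
  have hfin : ∀ i, Module.Finite K (Polynomial K ⧸ Ideal.span {e i}) := fun i =>
    Module.Finite.of_basis (AdjoinRoot.powerBasis (he i)).basis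
  have hrank : Module.finrank K ((i : ι) → Polynomial K ⧸ Ideal.span {e i}) =
      ∑ i, (e i).natDegree := by
    rw [Module.finrank_pi_fintype]
    exact Finset.sum_congr rfl fun i _ => finrank_quotient_span_eq_natDegree
  rw [← hrank]
  choose! s hs2 hsi hsj using hsep
  set c := 2 * Fintype.card ι + ∑ i, (e i).natDegree with hc
  have single : ∀ j (w : Polynomial K ⧸ Ideal.span {e j}), ∃ f : MvPolynomial (Fin 3) K,
      f.IsHomogeneous (a + b + c) ∧ φ f = Pi.single j w := by
    intro j w
    obtain ⟨w, rfl⟩ := Ideal.Quotient.mk_surjective w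
    set S := ∏ i ∈ Finset.univ.erase j, s i j
    have hSdeg : S.IsHomogeneous (∑ i ∈ Finset.univ.erase j, 2) :=
      IsHomogeneous.prod _ _ _ fun i hi => hs2 i j (Finset.ne_of_mem_erase hi)
    obtain ⟨x, y, hxy⟩ : IsCoprime (restrictLine (u j) (p j) S) (e j) := by
      rw [map_prod]
      exact IsCoprime.prod_left fun i hi => hsj i j (Finset.ne_of_mem_erase hi)
    have hdeg : ((x * w) % e j).natDegree ≤ a + b + c - ∑ i ∈ Finset.univ.erase j, 2 := by
      have h1 : ((x * w) % e j).natDegree ≤ (e j).natDegree :=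
        Polynomial.natDegree_le_natDegree (Polynomial.degree_mod_lt _ (he j)).le
      have h2 : (e j).natDegree ≤ ∑ i, (e i).natDegree :=
        Finset.single_le_sum (f := fun i => (e i).natDegree) (fun _ _ => Nat.zero_le _)
          (Finset.mem_univ j)
      have h3 := Finset.card_erase_le (s := Finset.univ) (a := j)
      simp only [Finset.sum_const, smul_eq_mul, Finset.card_univ] at h3 ⊢
      omega
    obtain ⟨f, hf, hfr⟩ := exists_isHomogeneous_restrictLine_eq (hup j) _ _ hdeg
    refine ⟨S * f, ?_, ?_⟩
    · convert hSdeg.mul hf using 1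
      have h3 := Finset.card_erase_le (s := Finset.univ) (a := j)
      simp only [Finset.sum_const, smul_eq_mul, Finset.card_univ] at h3 ⊢
      omega
    · ext1 i
      rcases eq_or_ne i j with rfl | hij
      · rw [Pi.single_eq_same, hφ, Ideal.Quotient.mk_eq_mk_iff_sub_mem,
          Ideal.mem_span_singleton, map_mul, hfr]
        refine ⟨-(y * w) - restrictLine (u i) (p i) S * ((x * w) / e i), ?_⟩
        have := EuclideanDomain.div_add_mod (x * w) (e i)
        linear_combination (restrictLine (u i) (p i)) S * this + w * hxy
      · rw [Pi.single_eq_of_ne hij, hφ0, map_mul, map_prod]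
        have hmem : i ∈ Finset.univ.erase j := Finset.mem_erase.2 ⟨hij, Finset.mem_univ i⟩
        exact ((hsi i j hij).trans (Finset.dvd_prod_of_mem
          (fun k => restrictLine (u i) (p i) (s k j)) hmem)).mul_right _
  refine finrank_le_mul_of_isRelPrime hA hB hA0 hB0 hAB φ.toLinearMap ?_ ?_ c fun w => ?_
  · intro f
    ext1 i
    exact (hφ0 _ _).2 (by rw [map_mul]; exact (heA i).mul_right _)
  · intro f
    ext1 i
    exact (hφ0 _ _).2 (by rw [map_mul]; exact (heB i).mul_right _)
  · choose f hf hfw using fun j => single j (w j)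
    refine ⟨∑ j, f j, IsHomogeneous.sum _ _ _ fun j _ => hf j, ?_⟩
    rw [map_sum]
    simp only [AlgHom.toLinearMap_apply, hfw]
    exact Finset.univ_sum_single w

theorem MvPolynomial.IsHomogeneous.aeval_mul_left {n : ℕ} {f : MvPolynomial (Fin n) K} {d : ℕ}
    (hf : f.IsHomogeneous d) {R : Type*} [CommRing R] [Algebra K R] (s : R) (g : Fin n → R) :
    MvPolynomial.aeval (fun i => s * g i) f = s ^ d * MvPolynomial.aeval g f := by
  simp only [aeval_def, eval₂_eq', Finset.mul_sum]
  refine Finset.sum_congr rfl fun m hm => ?_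
  have hdeg : ∑ i, m i = d := by
    rw [← Finsupp.degree_eq_sum]
    by_contra hne
    exact (mem_support_iff.1 hm) (hf.coeff_eq_zero hne)
  rw [← hdeg, ← Finset.prod_pow_eq_pow_sum]
  simp only [mul_pow, Finset.prod_mul_distrib]
  ring

theorem MvPolynomial.IsHomogeneous.eval_smul_s9 {n : ℕ} {f : MvPolynomial (Fin n) K} {d : ℕ}
    (hf : f.IsHomogeneous d) (c : K) (v : Fin n → K) :
    MvPolynomial.eval (c • v) f = c ^ d * MvPolynomial.eval v f := by
  have := hf.aeval_mul_left c v
  rwa [aeval_eq_eval] at this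

theorem natDegree_restrictLine_le_and_coeff {n : ℕ} {f : MvPolynomial (Fin n) K} {d : ℕ}
    (hf : f.IsHomogeneous d) (u p : Fin n → K) :
    (restrictLine u p f).natDegree ≤ d ∧ (restrictLine u p f).coeff d = eval p f := by
  have key : ∀ m : Fin n → ℕ, ∀ s : Finset (Fin n),
      (∏ i ∈ s, (Polynomial.C (u i) + Polynomial.C (p i) * Polynomial.X) ^ m i).natDegree ≤
        ∑ i ∈ s, m i ∧
      (∏ i ∈ s, (Polynomial.C (u i) + Polynomial.C (p i) * Polynomial.X) ^ m i).coeff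
        (∑ i ∈ s, m i) = ∏ i ∈ s, p i ^ m i := by
    intro m s
    have hl : ∀ i, (Polynomial.C (u i) + Polynomial.C (p i) * Polynomial.X).natDegree ≤ 1 :=
      fun i => by compute_degree
    have hpow : ∀ i, ((Polynomial.C (u i) + Polynomial.C (p i) * Polynomial.X) ^ m i).natDegree ≤
        m i := fun i => (Polynomial.natDegree_pow_le_of_le _ (hl i)).trans (by simp)
    induction s using Finset.cons_induction with
    | empty => simp
    | cons i s hi ih =>
      rw [Finset.prod_cons, Finset.sum_cons, Finset.prod_cons]
      refine ⟨Polynomial.natDegree_mul_le_of_le (hpow i) ih.1, ?_⟩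
      rw [Polynomial.coeff_mul_add_eq_of_natDegree_le (hpow i) ih.1, ih.2]
      congr 1
      have := Polynomial.coeff_pow_of_natDegree_le (m := m i) (hl i)
      simpa using this
  have hdeg : ∀ m ∈ f.support, ∑ i, m i = d := fun m hm => by
    rw [← Finsupp.degree_eq_sum]
    by_contra hne
    exact (mem_support_iff.1 hm) (hf.coeff_eq_zero hne)
  rw [restrictLine, aeval_def, eval₂_eq', eval_eq', Polynomial.finsetSum_coeff]
  refine ⟨Polynomial.natDegree_sum_le_of_forall_le _ _ fun m hm => ?_,
    Finset.sum_congr rfl fun m hm => ?_⟩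
  · rw [Polynomial.algebraMap_eq]
    refine (Polynomial.natDegree_C_mul_le _ _).trans ?_
    rw [← hdeg m hm]
    exact (key m _).1
  · rw [Polynomial.algebraMap_eq, Polynomial.coeff_C_mul, ← hdeg m hm, (key m _).2]

theorem natDegree_restrictLine_le {n : ℕ} {f : MvPolynomial (Fin n) K} {d : ℕ}
    (hf : f.IsHomogeneous d) (u p : Fin n → K) : (restrictLine u p f).natDegree ≤ d :=
  (natDegree_restrictLine_le_and_coeff hf u p).1

theorem coeff_restrictLine {n : ℕ} {f : MvPolynomial (Fin n) K} {d : ℕ}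
    (hf : f.IsHomogeneous d) (u p : Fin n → K) : (restrictLine u p f).coeff d = eval p f :=
  (natDegree_restrictLine_le_and_coeff hf u p).2

theorem exists_basis_of_linearIndependent {u p : Fin 3 → K} (h : LinearIndependent K ![u, p]) :
    ∃ B : Module.Basis (Fin 3) K (Fin 3 → K), B 1 = u ∧ B 2 = p := by
  obtain ⟨x, hx⟩ := exists_linearIndependent_cons_of_lt_finrank h (by simp)
  refine ⟨basisOfLinearIndependentOfCardEqFinrank hx (by simp), ?_, ?_⟩
  · rw [coe_basisOfLinearIndependentOfCardEqFinrank]; rfl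
  · rw [coe_basisOfLinearIndependentOfCardEqFinrank]; rfl

theorem exists_linearIndependent_pair {p : Fin 3 → K} (hp : p ≠ 0) :
    ∃ u, LinearIndependent K ![u, p] := by
  have h1 : LinearIndependent K ![p] := by
    rw [linearIndependent_unique_iff]; exact hp
  exact exists_linearIndependent_cons_of_lt_finrank h1 (by simp)

theorem X_eq_sum_functionalForm_coord (B : Module.Basis (Fin 3) K (Fin 3 → K)) (i : Fin 3) :
    (X i : MvPolynomial (Fin 3) K) = ∑ k, C (B k i) * functionalForm (B.coord k) := by
  simp only [functionalForm, linForm, Finset.mul_sum]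
  rw [Finset.sum_comm]
  have h : ∀ j : Fin 3, ∑ k, B.coord k (Pi.single j 1) * B k i = (Pi.single j 1 : Fin 3 → K) i := by
    intro j
    have := congrFun (B.sum_repr (Pi.single j 1)) i
    simpa using this
  have h2 : ∀ j : Fin 3, ∑ k, C (B k i) * (C (B.coord k (Pi.single j 1)) * X j) =
      C ((Pi.single j 1 : Fin 3 → K) i) * X j := by
    intro j
    rw [← h j, map_sum, Finset.sum_mul]
    refine Finset.sum_congr rfl fun k _ => ?_
    rw [map_mul]; ring
  rw [Finset.sum_congr rfl fun j _ => h2 j, Finset.sum_eq_single i]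
  · simp
  · intro j _ hj
    simp [Pi.single_eq_of_ne hj.symm]
  · simp

theorem exists_linForm_dvd_of_restrictLine_eq_zero {A : MvPolynomial (Fin 3) K} {d : ℕ}
    (hA : A.IsHomogeneous d) {u p : Fin 3 → K} (h : LinearIndependent K ![u, p])
    (h0 : restrictLine u p A = 0) : ∃ a : Fin 3 → K, a ≠ 0 ∧ linForm a ∣ A := by
  obtain ⟨B, rfl, rfl⟩ := exists_basis_of_linearIndependent h
  refine ⟨fun i => B.coord 0 (Pi.single i 1), ?_, ?_⟩
  · intro ha
    have := eval_functionalForm (B.coord 0) (B 0)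
    rw [functionalForm, ha] at this
    simp [linForm] at this
  set α := functionalForm (B.coord 1) with hα
  set β := functionalForm (B.coord 2)
  set γ := functionalForm (B.coord 0)
  change γ ∣ A
  have hα0 : α ≠ 0 := by
    intro h
    have := eval_functionalForm (B.coord 1) (B 1)
    rw [← hα, h] at this
    simp at this
  have hzero : aeval (fun i => C (B 1 i) * α + C (B 2 i) * β) A = 0 := by
    apply IsFractionRing.injective (MvPolynomial (Fin 3) K) (FractionRing (MvPolynomial (Fin 3) K))
    set ψ := algebraMap (MvPolynomial (Fin 3) K) (FractionRing (MvPolynomial (Fin 3) K)) with hψ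
    have hα1 : ψ α ≠ 0 := by simpa [hψ] using hα0
    rw [map_zero, ← aeval_algebraMap_apply]
    have hfun : (ψ ∘ fun i => C (B 1 i) * α + C (B 2 i) * β) =
        fun i => ψ α * Polynomial.aeval (ψ β / ψ α)
          (Polynomial.C (B 1 i) + Polynomial.C (B 2 i) * Polynomial.X) := by
      funext i
      have hC : ∀ x : K, ψ (C x) = algebraMap K _ x := fun x => rfl
      simp only [Function.comp_apply, map_add, map_mul, Polynomial.aeval_C, Polynomial.aeval_X, hC]
      field_simp
    rw [hfun, hA.aeval_mul_left]
    have : aeval (fun i => Polynomial.aeval (ψ β / ψ α)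
        (Polynomial.C (B 1 i) + Polynomial.C (B 2 i) * Polynomial.X)) A =
        Polynomial.aeval (ψ β / ψ α) (restrictLine (B 1) (B 2) A) := by
      rw [restrictLine, ← comp_aeval_apply]
    rw [this, h0, map_zero, mul_zero]
  rw [← Ideal.mem_span_singleton, ← Ideal.Quotient.eq_zero_iff_mem]
  have hmk : Ideal.Quotient.mkₐ K (Ideal.span {γ}) A =
      Ideal.Quotient.mkₐ K (Ideal.span {γ}) (aeval (fun i => C (B 1 i) * α + C (B 2 i) * β) A) := by
    conv_lhs => rw [← aeval_X_left_apply A]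
    rw [comp_aeval_apply, comp_aeval_apply]
    congr 2
    funext i
    rw [X_eq_sum_functionalForm_coord B i, Ideal.Quotient.mkₐ_eq_mk,
      Ideal.Quotient.mk_eq_mk_iff_sub_mem, Ideal.mem_span_singleton, Fin.sum_univ_three]
    exact ⟨C (B 0 i), by ring⟩
  rw [hzero, map_zero] at hmk
  exact hmk

/-- Direction vectors of the `q + 1` lines through the last vector of a basis `B`. -/
noncomputable def pencilVec (B : Module.Basis (Fin 3) K (Fin 3 → K)) : Option K → Fin 3 → K
  | none => B 1
  | some x => B 0 + x • B 1

/-- Representatives of the points of the plane, sorted by the lines through the last vector of a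
basis `B`. -/
noncomputable def pointVec (B : Module.Basis (Fin 3) K (Fin 3 → K)) :
    Option (Option K × K) → Fin 3 → K
  | none => B 2
  | some (j, y) => pencilVec B j + y • B 2

theorem eq_of_pointVec_eq_smul (B : Module.Basis (Fin 3) K (Fin 3 → K))
    {s t : Option (Option K × K)} {c : K} (h : pointVec B s = c • pointVec B t) : s = t := by
  have h0 := congrArg (fun v => B.repr v 0) h
  have h1 := congrArg (fun v => B.repr v 1) h
  have h2 := congrArg (fun v => B.repr v 2) h
  rcases s with _ | ⟨_ | x, y⟩ <;> rcases t with _ | ⟨_ | x', y'⟩ <;>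
    simp [pointVec, pencilVec] at h0 h1 h2 ⊢ <;> grind

theorem pointVec_ne_zero (B : Module.Basis (Fin 3) K (Fin 3 → K)) (s : Option (Option K × K)) :
    pointVec B s ≠ 0 := by
  intro h
  have h0 := eq_of_pointVec_eq_smul B (s := s) (t := none) (c := 0) (by simp [h])
  have h1 := eq_of_pointVec_eq_smul B (s := s) (t := some (none, 0)) (c := 0) (by simp [h])
  rw [h0] at h1
  simp at h1

theorem linearIndependent_pencilVec (B : Module.Basis (Fin 3) K (Fin 3 → K)) (j : Option K) :
    LinearIndependent K ![pencilVec B j, B 2] := by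
  rw [LinearIndependent.pair_iff]
  intro s t h
  have h0 := congrArg (fun v => B.repr v 0) h
  have h1 := congrArg (fun v => B.repr v 1) h
  have h2 := congrArg (fun v => B.repr v 2) h
  rcases j with _ | x <;> simp [pencilVec] at h0 h1 h2 ⊢ <;> grind

theorem exists_functional_pencilVec (B : Module.Basis (Fin 3) K (Fin 3 → K)) (i : Option K) :
    ∃ f : (Fin 3 → K) →ₗ[K] K, f (B 2) = 0 ∧ f (pencilVec B i) = 0 ∧
      ∀ j, i ≠ j → f (pencilVec B j) ≠ 0 := by
  rcases i with _ | x
  · refine ⟨B.coord 0, by simp, by simp [pencilVec], fun j hj => ?_⟩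
    rcases j with _ | y
    · exact absurd rfl hj
    · simp [pencilVec]
  · refine ⟨B.coord 1 - x • B.coord 0, by simp, by simp [pencilVec], fun j hj => ?_⟩
    rcases j with _ | y
    · simp [pencilVec]
    · have : y - x ≠ 0 := sub_ne_zero.2 fun h => hj (by rw [h])
      simpa [pencilVec] using this

/-- The number of rational points of the plane curve `A = 0`. -/
noncomputable def pointCount (A : MvPolynomial (Fin 3) K) : ℕ :=
  Nat.card {p : Projectivization K (Fin 3 → K) // eval p.rep A = 0}

theorem eval_rep_mk_eq_zero_iff {A : MvPolynomial (Fin 3) K} {d : ℕ} (hA : A.IsHomogeneous d)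
    {v : Fin 3 → K} (hv : v ≠ 0) :
    eval (Projectivization.mk K v hv).rep A = 0 ↔ eval v A = 0 := by
  obtain ⟨c, hc⟩ := Projectivization.exists_smul_eq_mk_rep K v hv
  rw [← hc, Units.smul_def, hA.eval_smul_s9]
  simp

theorem card_projectivization [Fintype K] :
    Nat.card (Projectivization K (Fin 3 → K)) = (Fintype.card K + 1) * Fintype.card K + 1 := by
  rw [Projectivization.card_of_finrank K _ (n := 3) (by simp), Nat.card_eq_fintype_card]
  simp [Finset.sum_range_succ]
  ring

theorem pointVec_bijective [Fintype K] (B : Module.Basis (Fin 3) K (Fin 3 → K)) :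
    Function.Bijective fun s => Projectivization.mk K (pointVec B s) (pointVec_ne_zero B s) := by
  rw [Nat.bijective_iff_injective_and_card]
  refine ⟨fun s t h => ?_, ?_⟩
  · obtain ⟨c, hc⟩ := (Projectivization.mk_eq_mk_iff' K _ _ _ _).1 h
    exact eq_of_pointVec_eq_smul B hc.symm
  · rw [card_projectivization, Nat.card_eq_fintype_card]
    simp

open Classical in
theorem pointCount_eq [Fintype K] {A : MvPolynomial (Fin 3) K} {d : ℕ} (hA : A.IsHomogeneous d)
    (B : Module.Basis (Fin 3) K (Fin 3 → K)) :
    pointCount A = (if eval (B 2) A = 0 then 1 else 0) +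
      ∑ j, (Finset.univ.filter fun y =>
        (restrictLine (pencilVec B j) (B 2) A).eval y = 0).card := by
  have e : {s // eval (pointVec B s) A = 0} ≃
      {p : Projectivization K (Fin 3 → K) // eval p.rep A = 0} :=
    (Equiv.ofBijective _ (pointVec_bijective B)).subtypeEquiv fun s =>
      (eval_rep_mk_eq_zero_iff hA (pointVec_ne_zero B s)).symm
  rw [pointCount, ← Nat.card_congr e, Nat.card_eq_fintype_card, Fintype.card_subtype,
    Finset.card_filter, Fintype.sum_option, Fintype.sum_prod_type]
  simp only [Finset.card_filter, eval_restrictLine]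
  rfl

open Classical in
theorem card_filter_eval_eq_zero_le [Fintype K] {g : Polynomial K} (hg : g ≠ 0) :
    (Finset.univ.filter fun y => g.eval y = 0).card ≤ g.natDegree := by
  refine Polynomial.card_le_degree_of_subset_roots fun y hy => ?_
  rw [Polynomial.mem_roots hg]
  simpa using hy

theorem pointCount_le [Fintype K] {A : MvPolynomial (Fin 3) K} {d : ℕ} (hA : A.IsHomogeneous d)
    (hd : 1 ≤ d) (hline : ¬ ∃ a : Fin 3 → K, a ≠ 0 ∧ linForm a ∣ A) :
    pointCount A ≤ (d - 1) * Fintype.card K + d := by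
  classical
  by_cases hpt : ∃ p : Projectivization K (Fin 3 → K), eval p.rep A = 0
  · obtain ⟨p, hp⟩ := hpt
    obtain ⟨u, hu⟩ := exists_linearIndependent_pair p.rep_nonzero
    obtain ⟨B, -, hB⟩ := exists_basis_of_linearIndependent hu
    rw [pointCount_eq hA B, hB, if_pos hp]
    have h : ∀ j, (Finset.univ.filter fun y =>
        (restrictLine (pencilVec B j) p.rep A).eval y = 0).card ≤ d - 1 := by
      intro j
      have hg : restrictLine (pencilVec B j) p.rep A ≠ 0 := fun h0 =>
        hline (exists_linForm_dvd_of_restrictLine_eq_zero hA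
          (hB ▸ linearIndependent_pencilVec B j) h0)
      refine (card_filter_eval_eq_zero_le hg).trans ?_
      have hle := natDegree_restrictLine_le hA (pencilVec B j) p.rep
      have hne : (restrictLine (pencilVec B j) p.rep A).natDegree ≠ d := by
        intro h
        have hc := coeff_restrictLine hA (pencilVec B j) p.rep
        rw [hp, ← h, Polynomial.coeff_natDegree, Polynomial.leadingCoeff_eq_zero] at hc
        exact hg hc
      omega
    have hs := Finset.sum_le_card_nsmul Finset.univ _ _ fun j _ => h j
    rw [Finset.card_univ, Fintype.card_option, smul_eq_mul] at hs
    have : (Fintype.card K + 1) * (d - 1) = (d - 1) * Fintype.card K + (d - 1) := by ring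
    omega
  · have : IsEmpty {p : Projectivization K (Fin 3 → K) // eval p.rep A = 0} :=
      ⟨fun p => hpt ⟨p.1, p.2⟩⟩
    simp [pointCount]

theorem pointCount_mul_le [Fintype K] (A B : MvPolynomial (Fin 3) K) :
    pointCount (A * B) ≤ pointCount A + pointCount B := by
  simp only [pointCount, map_mul, mul_eq_zero]
  exact Set.ncard_union_le {p : Projectivization K (Fin 3 → K) | eval p.rep A = 0}
    {p | eval p.rep B = 0}

theorem ne_zero_of_not_linForm_dvd {G : MvPolynomial (Fin 3) K}
    (hline : ¬ ∃ a : Fin 3 → K, a ≠ 0 ∧ linForm a ∣ G) : G ≠ 0 := fun h =>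
  hline ⟨fun _ => 1, fun h => by simpa using congrFun h 0, h ▸ dvd_zero _⟩

theorem irreducible_of_lt_pointCount [Fintype K] {G : MvPolynomial (Fin 3) K} {d : ℕ}
    (hG : G.IsHomogeneous d) (hd : 1 ≤ d)
    (hline : ¬ ∃ a : Fin 3 → K, a ≠ 0 ∧ linForm a ∣ G)
    (hcount : (d - 2) * Fintype.card K + d < pointCount G) : Irreducible G := by
  have hG0 := ne_zero_of_not_linForm_dvd hline
  refine ⟨fun hu => ?_, fun A B hAB => ?_⟩
  · have := hG.totalDegree hG0
    rw [isUnit_iff_eq_C_of_isReduced] at hu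
    obtain ⟨r, -, rfl⟩ := hu
    simp at this
    omega
  by_contra! hcon
  subst hAB
  have hAB : (A * B).IsHomogeneous d ∧ (B * A).IsHomogeneous d := ⟨hG, mul_comm A B ▸ hG⟩
  obtain ⟨a, ha⟩ := hAB.1.exists_of_mul hG0
  obtain ⟨b, hb⟩ := hAB.2.exists_of_mul (mul_comm A B ▸ hG0)
  have hab := (ha.mul hb).inj_right hG hG0
  have hpos : ∀ {F : MvPolynomial (Fin 3) K} {k : ℕ}, F.IsHomogeneous k → F ≠ 0 → ¬ IsUnit F →
      1 ≤ k := by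
    intro F k hF hF0 hFu
    by_contra! hk
    obtain rfl : k = 0 := by omega
    rw [← totalDegree_zero_iff_isHomogeneous, totalDegree_eq_zero_iff_eq_C] at hF
    refine hFu ?_
    rw [hF] at hF0 ⊢
    exact (isUnit_iff_ne_zero.2 fun h => hF0 (by rw [h, C_0])).map C
  have ha1 := hpos ha (left_ne_zero_of_mul hG0) hcon.1
  have hb1 := hpos hb (right_ne_zero_of_mul hG0) hcon.2
  have h1 := pointCount_le ha ha1 fun ⟨l, hl, h⟩ => hline ⟨l, hl, h.mul_right _⟩
  have h2 := pointCount_le hb hb1 fun ⟨l, hl, h⟩ => hline ⟨l, hl, h.mul_left _⟩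
  have h3 := pointCount_mul_le A B
  have h4 : (a - 1) * Fintype.card K + (b - 1) * Fintype.card K = (d - 2) * Fintype.card K := by
    rw [← add_mul]
    congr 1
    omega
  omega

/-- The derivative of a polynomial in the direction of a vector. -/
noncomputable def directionalDeriv {n : ℕ} (p : Fin n → K) (f : MvPolynomial (Fin n) K) :
    MvPolynomial (Fin n) K :=
  ∑ i, C (p i) * pderiv i f

theorem isHomogeneous_directionalDeriv {n d : ℕ} (p : Fin n → K) {f : MvPolynomial (Fin n) K}
    (hf : f.IsHomogeneous d) : (directionalDeriv p f).IsHomogeneous (d - 1) :=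
  IsHomogeneous.sum _ _ _ fun _ _ => hf.pderiv.C_mul _

theorem derivative_restrictLine {n : ℕ} (u p : Fin n → K) (f : MvPolynomial (Fin n) K) :
    Polynomial.derivative (restrictLine u p f) = restrictLine u p (directionalDeriv p f) := by
  induction f using MvPolynomial.induction_on with
  | C a => simp [restrictLine, directionalDeriv]
  | add f g hf hg =>
    simp only [map_add, hf, hg, directionalDeriv, mul_add, Finset.sum_add_distrib]
  | mul_X f i hf =>
    have hX : restrictLine u p (X i) = Polynomial.C (u i) + Polynomial.C (p i) * Polynomial.X := by
      simp [restrictLine]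
    have hC : ∀ a : K, restrictLine u p (C a) = Polynomial.C a := by simp [restrictLine]
    rw [map_mul, Polynomial.derivative_mul, hf, hX]
    simp only [directionalDeriv, Derivation.leibniz, smul_eq_mul, mul_add, Finset.sum_add_distrib,
      map_add, map_sum, map_mul, pderiv_X, hC, Finset.sum_mul, hX]
    rw [add_comm]
    congr 1
    · rw [Finset.sum_eq_single i]
      · simp; ring
      · intro j _ hj
        simp [Pi.single_eq_of_ne hj.symm]
      · simp
    · rw [← Finset.sum_add_distrib]
      exact Finset.sum_congr rfl fun j _ => by ring

/-- The form `∑ Xᵢ ^ q * ∂G/∂Xᵢ`, which vanishes at the points whose Frobenius image lies on the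
tangent line. -/
noncomputable def frobeniusForm {n : ℕ} [Fintype K] (G : MvPolynomial (Fin n) K) :
    MvPolynomial (Fin n) K :=
  ∑ i, X i ^ Fintype.card K * pderiv i G

theorem isHomogeneous_frobeniusForm {n d : ℕ} [Fintype K] {G : MvPolynomial (Fin n) K}
    (hG : G.IsHomogeneous d) : (frobeniusForm G).IsHomogeneous (Fintype.card K + (d - 1)) :=
  IsHomogeneous.sum _ _ _ fun i _ => by
    simpa using ((isHomogeneous_X K i).pow (Fintype.card K)).mul hG.pderiv

theorem restrictLine_frobeniusForm {n d : ℕ} [Fintype K] {G : MvPolynomial (Fin n) K}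
    (hG : G.IsHomogeneous d) (u p : Fin n → K) :
    restrictLine u p (frobeniusForm G) = (d : Polynomial K) * restrictLine u p G +
      (Polynomial.X ^ Fintype.card K - Polynomial.X) *
        Polynomial.derivative (restrictLine u p G) := by
  have hE := congrArg (restrictLine u p) hG.sum_X_mul_pderiv
  have hX : ∀ i, restrictLine u p (X i) = Polynomial.C (u i) + Polynomial.C (p i) * Polynomial.X :=
    fun i => by simp [restrictLine]
  have hC : ∀ a : K, restrictLine u p (C a) = Polynomial.C a := by simp [restrictLine]
  have hF : ∀ i, (Polynomial.C (u i) + Polynomial.C (p i) * Polynomial.X) ^ Fintype.card K =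
      Polynomial.C (u i) + Polynomial.C (p i) * Polynomial.X ^ Fintype.card K := fun i => by
    rw [← FiniteField.expand_card]
    simp
  rw [nsmul_eq_mul, map_mul, map_natCast] at hE
  rw [← hE, derivative_restrictLine]
  simp only [frobeniusForm, directionalDeriv, map_sum, map_mul, map_pow, hX, hC, hF,
    Finset.mul_sum, ← Finset.sum_add_distrib]
  exact Finset.sum_congr rfl fun i _ => by ring

theorem exists_tangent_vector {v : Fin 3 → K} (hv : v ≠ 0) (G : MvPolynomial (Fin 3) K) :
    ∃ w, LinearIndependent K ![v, w] ∧ eval v (directionalDeriv w G) = 0 := by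
  set L := linMap fun i => eval v (pderiv i G) with hL
  have hker : 2 ≤ Module.finrank K (LinearMap.ker L) := by
    have h1 := L.finrank_range_add_finrank_ker
    have h2 := (LinearMap.range L).finrank_le
    simp at h1 h2
    omega
  have hlt : ¬ LinearMap.ker L ≤ K ∙ v := fun h => by
    have h1 := Submodule.finrank_mono h
    have h2 := finrank_span_singleton (K := K) hv
    omega
  obtain ⟨w, hw, hwv⟩ := Set.not_subset.1 hlt
  refine ⟨w, (LinearIndependent.pair_iff' hv).2 fun a ha =>
    hwv (Submodule.mem_span_singleton.2 ⟨a, ha⟩), ?_⟩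
  have : L w = 0 := hw
  rw [← this]
  simp [hL, linMap, directionalDeriv, mul_comm]

theorem X_sq_dvd_of_eval_eq_zero {f : Polynomial K} (h0 : f.eval 0 = 0)
    (h1 : (Polynomial.derivative f).eval 0 = 0) : Polynomial.X ^ 2 ∣ f := by
  rw [Polynomial.X_pow_dvd_iff]
  intro k hk
  rw [← Polynomial.coeff_zero_eq_eval_zero] at h0 h1
  rw [Polynomial.coeff_derivative] at h1
  interval_cases k
  · exact h0
  · simpa using h1

theorem two_mul_pointCount_le [Fintype K] {G : MvPolynomial (Fin 3) K} {d : ℕ}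
    (hG : G.IsHomogeneous d) (hG0 : G ≠ 0) (hF0 : frobeniusForm G ≠ 0)
    (hrel : IsRelPrime G (frobeniusForm G)) :
    2 * pointCount G ≤ d * (Fintype.card K + (d - 1)) := by
  classical
  let ι := {p : Projectivization K (Fin 3 → K) // eval p.rep G = 0}
  have : Finite (Projectivization K (Fin 3 → K)) := Nat.finite_of_card_ne_zero (by
    rw [card_projectivization]; omega)
  have : Fintype ι := Fintype.ofFinite ι
  choose w hw hwt using fun p : ι => exists_tangent_vector p.1.rep_nonzero G
  have hX2 : ∀ p : ι, Polynomial.X ^ 2 ∣ restrictLine p.1.rep (w p) G := fun p =>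
    X_sq_dvd_of_eval_eq_zero (by rw [eval_restrictLine, zero_smul, add_zero, p.2])
      (by rw [derivative_restrictLine, eval_restrictLine, zero_smul, add_zero, hwt])
  have key := sum_natDegree_le_mul hG (isHomogeneous_frobeniusForm hG) hG0 hF0 hrel
    (fun p : ι => p.1.rep) w (fun _ => Polynomial.X ^ 2) (fun _ => by simp) hw hX2 ?_ ?_
  · rw [pointCount, Nat.card_eq_fintype_card]
    simpa [mul_comm, ι] using key
  · intro p
    rw [restrictLine_frobeniusForm hG]
    refine dvd_add ((hX2 p).mul_left _) ?_
    rw [pow_two]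
    refine mul_dvd_mul (dvd_sub (dvd_pow_self _ Fintype.card_ne_zero) dvd_rfl) ?_
    rw [Polynomial.X_dvd_iff, Polynomial.coeff_zero_eq_eval_zero, derivative_restrictLine,
      eval_restrictLine, zero_smul, add_zero, hwt]
  · intro i j hij
    have hli : LinearIndependent K ![i.1.rep, j.1.rep] := by
      have := (Projectivization.independent_pair_iff_ne i.1 j.1).2 fun h => hij (Subtype.ext h)
      rw [Projectivization.independent_iff] at this
      have heq : ![i.1.rep, j.1.rep] = Projectivization.rep ∘ ![i.1, j.1] := by
        ext a b
        fin_cases a <;> rfl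
      rwa [heq]
    obtain ⟨B, hB1, hB2⟩ := exists_basis_of_linearIndependent hli
    refine ⟨functionalForm (B.coord 2) ^ 2, ?_, ?_, ?_⟩
    · exact (isHomogeneous_linForm _).pow 2
    · rw [map_pow, restrictLine_functionalForm, ← hB1]
      simp [mul_pow]
    · rw [map_pow, restrictLine_functionalForm, ← hB2]
      refine IsCoprime.pow ⟨1, -Polynomial.C (B.coord 2 (w j)), ?_⟩
      simp

theorem prod_X_sub_C_eq_X_pow_card_sub_X [Fintype K] :
    ∏ a : K, (Polynomial.X - Polynomial.C a) = Polynomial.X ^ Fintype.card K - Polynomial.X := by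
  have hdeg := FiniteField.X_pow_card_sub_X_natDegree_eq K (Fintype.one_lt_card (α := K))
  have hmonic : (Polynomial.X ^ Fintype.card K - Polynomial.X : Polynomial K).Monic :=
    Polynomial.monic_X_pow_sub (by
      rw [Polynomial.degree_X]; exact_mod_cast Fintype.one_lt_card (α := K))
  have := Polynomial.prod_multiset_X_sub_C_of_monic_of_roots_card_eq hmonic (by
    rw [FiniteField.roots_X_pow_card_sub_X, hdeg]; rfl)
  rwa [FiniteField.roots_X_pow_card_sub_X] at this

theorem dvd_prod_mul_of_dvd_X_pow_card_sub_X_mul [Fintype K] [DecidableEq K] {g k : Polynomial K}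
    (h : g ∣ (Polynomial.X ^ Fintype.card K - Polynomial.X) * k) :
    g ∣ (∏ a ∈ Finset.univ.filter (fun y => g.eval y = 0),
      (Polynomial.X - Polynomial.C a)) * k := by
  rw [← prod_X_sub_C_eq_X_pow_card_sub_X,
    ← Finset.prod_filter_mul_prod_filter_not _ (fun y => g.eval y = 0), mul_right_comm] at h
  refine IsCoprime.dvd_of_dvd_mul_right (IsCoprime.prod_right fun a ha => ?_) h
  rw [isCoprime_comm, (Polynomial.irreducible_X_sub_C a).coprime_iff_not_dvd,
    Polynomial.dvd_iff_isRoot]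
  exact (Finset.mem_filter.1 ha).2

open Classical in
theorem natDegree_le_card_roots_add_natDegree_gcd [Fintype K] {g : Polynomial K} (hg : g ≠ 0)
    (h : g ∣ (Polynomial.X ^ Fintype.card K - Polynomial.X) * Polynomial.derivative g) :
    g.natDegree ≤ (Finset.univ.filter fun y => g.eval y = 0).card +
      (EuclideanDomain.gcd g (Polynomial.derivative g)).natDegree := by
  set e := EuclideanDomain.gcd g (Polynomial.derivative g) with he
  have he0 : e ≠ 0 := fun h => hg (EuclideanDomain.gcd_eq_zero_iff.1 h).1
  obtain ⟨a, ha⟩ := EuclideanDomain.gcd_dvd_left g (Polynomial.derivative g)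
  obtain ⟨b, hb⟩ := EuclideanDomain.gcd_dvd_right g (Polynomial.derivative g)
  rw [← he] at ha hb
  have hab : IsCoprime a b := by
    refine ⟨EuclideanDomain.gcdA g (Polynomial.derivative g),
      EuclideanDomain.gcdB g (Polynomial.derivative g), mul_left_cancel₀ he0 ?_⟩
    have := EuclideanDomain.gcd_eq_gcd_ab g (Polynomial.derivative g)
    rw [← he] at this
    linear_combination -this - EuclideanDomain.gcdA g (Polynomial.derivative g) * ha -
      EuclideanDomain.gcdB g (Polynomial.derivative g) * hb
  have hR := dvd_prod_mul_of_dvd_X_pow_card_sub_X_mul h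
  set R := ∏ a ∈ Finset.univ.filter (fun y => g.eval y = 0), (Polynomial.X - Polynomial.C a)
    with hRdef
  have haR : a ∣ R := by
    refine hab.dvd_of_dvd_mul_right ((mul_dvd_mul_iff_left he0).1 ?_)
    rw [← ha, mul_left_comm, ← hb]
    exact hR
  have hR0 : R ≠ 0 := Finset.prod_ne_zero_iff.2 fun a _ => Polynomial.X_sub_C_ne_zero a
  have hRdeg : R.natDegree = (Finset.univ.filter fun y => g.eval y = 0).card := by
    rw [hRdef, Polynomial.natDegree_prod_of_monic _ _ fun a _ => Polynomial.monic_X_sub_C a]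
    simp
  have ha0 : a ≠ 0 := fun h => hg (by rw [ha, h, mul_zero])
  have h1 := Polynomial.natDegree_le_of_dvd haR hR0
  have h2 : g.natDegree = e.natDegree + a.natDegree := by
    conv_lhs => rw [ha]
    exact Polynomial.natDegree_mul he0 ha0
  omega

theorem two_mul_card_filter_eval_eq_zero_le [Fintype K] [DecidableEq K] {g : Polynomial K}
    (hg : g ≠ 0) (h : Polynomial.derivative g = 0) :
    2 * (Finset.univ.filter fun y => g.eval y = 0).card ≤ g.natDegree := by
  refine le_trans ?_ g.card_roots'
  rw [mul_comm, ← smul_eq_mul, ← Finset.sum_const]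
  calc ∑ y ∈ Finset.univ.filter (fun y => g.eval y = 0), 2
      ≤ ∑ y ∈ Finset.univ.filter (fun y => g.eval y = 0), g.roots.count y := by
        refine Finset.sum_le_sum fun y hy => ?_
        have hy' : g.IsRoot y := (Finset.mem_filter.1 hy).2
        rw [Polynomial.count_roots]
        exact (Polynomial.one_lt_rootMultiplicity_iff_isRoot hg).2 ⟨hy', by simp [h]⟩
    _ ≤ ∑ y, g.roots.count y :=
        Finset.sum_le_sum_of_subset (Finset.filter_subset _ _)
    _ = g.roots.card := Multiset.sum_count_eq_card fun _ _ => Finset.mem_univ _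

theorem pointCount_bound_of_dvd_frobeniusForm [Fintype K] {G : MvPolynomial (Fin 3) K} {d : ℕ}
    (hG : G.IsHomogeneous d) (hd : 1 ≤ d) (hirr : Irreducible G) (hdvd : G ∣ frobeniusForm G)
    (hlt : pointCount G < (Fintype.card K + 1) * Fintype.card K + 1) :
    2 * pointCount G ≤ (Fintype.card K + 1) * d ∨
      d * (Fintype.card K + 1) ≤ pointCount G + d * (d - 1) := by
  classical
  obtain ⟨p, hp⟩ : ∃ p : Projectivization K (Fin 3 → K), eval p.rep G ≠ 0 := by
    by_contra! h
    rw [← card_projectivization, pointCount, Nat.card_congr (Equiv.subtypeUnivEquiv h)] at hlt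
    exact hlt.false
  obtain ⟨u, hu⟩ := exists_linearIndependent_pair p.rep_nonzero
  obtain ⟨B, -, hB⟩ := exists_basis_of_linearIndependent hu
  rw [pointCount_eq hG B, hB, if_neg hp, zero_add]
  have hcoeff := fun j => coeff_restrictLine hG (pencilVec B j) p.rep
  have hg0 : ∀ j, restrictLine (pencilVec B j) p.rep G ≠ 0 := fun j h => by
    have := hcoeff j
    rw [h] at this
    exact hp (by simpa using this.symm)
  have hdeg : ∀ j, (restrictLine (pencilVec B j) p.rep G).natDegree = d := fun j =>
    Polynomial.natDegree_eq_of_le_of_coeff_ne_zero (natDegree_restrictLine_le hG _ _)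
      (by rw [hcoeff]; exact hp)
  by_cases hD : directionalDeriv p.rep G = 0
  · left
    rw [Finset.mul_sum]
    refine (Finset.sum_le_card_nsmul _ _ d fun j _ => ?_).trans (by simp)
    rw [← hdeg j]
    exact two_mul_card_filter_eval_eq_zero_le (hg0 j)
      (by rw [derivative_restrictLine, hD, map_zero])
  · right
    have hDhom := isHomogeneous_directionalDeriv p.rep hG
    have hrel : IsRelPrime G (directionalDeriv p.rep G) := by
      rw [hirr.isRelPrime_iff_not_dvd]
      rintro ⟨A, hA⟩
      have hA0 : A ≠ 0 := fun h => hD (by rw [hA, h, mul_zero])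
      have h1 := congrArg totalDegree hA
      rw [totalDegree_mul_of_isDomain hirr.ne_zero hA0, hG.totalDegree hirr.ne_zero,
        hDhom.totalDegree hD] at h1
      omega
    have key := sum_natDegree_le_mul hG hDhom hirr.ne_zero hD hrel (pencilVec B) (fun _ => p.rep)
      (fun j => EuclideanDomain.gcd (restrictLine (pencilVec B j) p.rep G)
        (Polynomial.derivative (restrictLine (pencilVec B j) p.rep G)))
      (fun j h => hg0 j (EuclideanDomain.gcd_eq_zero_iff.1 h).1)
      (fun j => hB ▸ linearIndependent_pencilVec B j)
      (fun j => EuclideanDomain.gcd_dvd_left _ _)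
      (fun j => derivative_restrictLine (pencilVec B j) p.rep G ▸ EuclideanDomain.gcd_dvd_right _ _)
      ?_
    · have hsum := Finset.sum_le_sum fun j (_ : j ∈ Finset.univ) =>
        natDegree_le_card_roots_add_natDegree_gcd (hg0 j) (by
          have := map_dvd (restrictLine (pencilVec B j) p.rep) hdvd
          rw [restrictLine_frobeniusForm hG] at this
          exact (dvd_add_right (dvd_mul_left _ _)).1 this)
      simp only [hdeg, Finset.sum_add_distrib, Finset.sum_const, Finset.card_univ,
        Fintype.card_option, smul_eq_mul] at hsum
      rw [mul_comm d]
      exact hsum.trans (Nat.add_le_add_left key _)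
    · intro i j hij
      obtain ⟨f, hfp, hfi, hfj⟩ := exists_functional_pencilVec B i
      rw [hB] at hfp
      refine ⟨functionalForm f ^ 2, (isHomogeneous_linForm _).pow 2, ?_, ?_⟩
      · simp [restrictLine_functionalForm, hfi, hfp]
      · rw [map_pow, restrictLine_functionalForm, hfp]
        refine IsCoprime.pow_left (⟨Polynomial.C (f (pencilVec B j))⁻¹, 0, ?_⟩)
        simp [← map_mul, hfj j hij]

theorem card_le_of_pointCount_eq [Fintype K] {G : MvPolynomial (Fin 3) K} {d : ℕ}
    (hG : G.IsHomogeneous d) (hd : 3 ≤ d)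
    (hline : ¬ ∃ a : Fin 3 → K, a ≠ 0 ∧ linForm a ∣ G)
    (hN : pointCount G = (d - 1) * Fintype.card K + 1) : Fintype.card K ≤ (d - 1) ^ 2 := by
  by_contra! hq
  obtain ⟨e, rfl⟩ : ∃ e, d = e + 3 := ⟨d - 3, by omega⟩
  set q := Fintype.card K
  simp only [show e + 3 - 1 = e + 2 by omega] at hN hq
  have hirr : Irreducible G := irreducible_of_lt_pointCount hG (by omega) hline (by
    rw [hN, show e + 3 - 2 = e + 1 by omega]
    nlinarith)
  by_cases hdvd : G ∣ frobeniusForm G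
  · rcases pointCount_bound_of_dvd_frobeniusForm hG (by omega) hirr hdvd
      (by rw [hN]; nlinarith) with h | h
    · rw [hN] at h
      nlinarith
    · rw [hN, show e + 3 - 1 = e + 2 by omega] at h
      nlinarith
  · have h := two_mul_pointCount_le hG hirr.ne_zero (fun h => hdvd (h ▸ dvd_zero _))
      (hirr.isRelPrime_iff_not_dvd.2 hdvd)
    rw [hN, show e + 3 - 1 = e + 2 by omega] at h
    nlinarith

theorem eq_linForm_of_isHomogeneous_one {n : ℕ} {G : MvPolynomial (Fin n) K}
    (hG : G.IsHomogeneous 1) : ∃ a : Fin n → K, G = linForm a := by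
  have hE := hG.sum_X_mul_pderiv
  have hC : ∀ i, pderiv i G = C (coeff 0 (pderiv i G)) := fun i => by
    rw [← totalDegree_eq_zero_iff_eq_C, totalDegree_zero_iff_isHomogeneous]
    exact hG.pderiv
  refine ⟨fun i => coeff 0 (pderiv i G), ?_⟩
  rw [one_smul] at hE
  conv_lhs => rw [← hE]
  exact Finset.sum_congr rfl fun i _ => by rw [mul_comm, ← hC]

theorem two_le_of_pointCount_eq [Fintype K] {G : MvPolynomial (Fin 3) K} {d : ℕ}
    (hG : G.IsHomogeneous d) (hline : ¬ ∃ a : Fin 3 → K, a ≠ 0 ∧ linForm a ∣ G)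
    (hN : pointCount G = (d - 1) * Fintype.card K + 1) : 2 ≤ d := by
  have hG0 := ne_zero_of_not_linForm_dvd hline
  by_contra! hd
  interval_cases d
  · rw [← totalDegree_zero_iff_isHomogeneous, totalDegree_eq_zero_iff_eq_C] at hG
    have hc : coeff 0 G ≠ 0 := fun h => hG0 (by rw [hG, h, C_0])
    rw [hG] at hN
    simp [pointCount, hc] at hN
  · obtain ⟨a, rfl⟩ := eq_linForm_of_isHomogeneous_one hG
    exact hline ⟨a, fun h => hG0 (by simp [h, linForm]), dvd_rfl⟩

theorem le_of_pointCount_eq [Fintype K] {G : MvPolynomial (Fin 3) K} {d : ℕ}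
    (hN : pointCount G = (d - 1) * Fintype.card K + 1) : d ≤ Fintype.card K + 2 := by
  have := Nat.finite_of_card_ne_zero (α := Projectivization K (Fin 3 → K)) (by
    rw [card_projectivization]; omega)
  have hle := Nat.card_le_card_of_injective
    (Subtype.val : {p : Projectivization K (Fin 3 → K) // eval p.rep G = 0} → _)
    Subtype.val_injective
  rw [card_projectivization] at hle
  change pointCount G ≤ _ at hle
  have := Nat.le_of_mul_le_mul_right (c := Fintype.card K) (by omega : (d - 1) * Fintype.card K ≤
    (Fintype.card K + 1) * Fintype.card K) Fintype.card_pos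
  omega

/-- A plane curve of degree `d` over `F_q` without `F_q`-line components
attaining the Sziklai bound `N_q(C) = (d-1)q + 1` has `d = 2` or `√q + 1 ≤ d ≤ q + 2`. -/
theorem extremal_curve_degree_range (K : Type) [Field K] [Fintype K]
    (d : ℕ) (G : MvPolynomial (Fin 3) K)
    (hhom : G.IsHomogeneous d) (hsf : Squarefree G)
    (hnoline : ¬ ∃ a : Fin 3 → K, a ≠ 0 ∧ linForm a ∣ G)
    (hN : Nat.card {p : Projectivization K (Fin 3 → K) // MvPolynomial.eval p.rep G = 0} =
      (d - 1) * Fintype.card K + 1) :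
    d = 2 ∨ (Real.sqrt (Fintype.card K) + 1 ≤ (d : ℝ) ∧ d ≤ Fintype.card K + 2) := by
  obtain hd | hd := (two_le_of_pointCount_eq hhom hnoline hN).eq_or_lt'
  · exact Or.inl hd
  refine Or.inr ⟨?_, le_of_pointCount_eq hN⟩
  have h := card_le_of_pointCount_eq hhom hd hnoline hN
  rw [← le_sub_iff_add_le, Real.sqrt_le_left
    (by rw [sub_nonneg]; exact_mod_cast (by omega : 1 ≤ d))]
  rw [← Nat.cast_one, ← Nat.cast_sub (by omega)]
  exact_mod_cast h
end
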